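/- arXiv:2509.14838 — 2 statements merged into one kernel-verified Lean document; each statement's English description precedes it below -/
import Mathlib

section
/- Let Δ be a pure simplicial complex. Then S_2-depth(S/I_Δ^(2)) ≥ S_2-depth(S/I_Δ^(ℓ)) for all ℓ ≥ 3. -/
/-!
Common definitions for formalizing "The Serre depth of Stanley–Reisner rings and
the depth of their symbolic powers" (Muta–Terai).
-/

open CategoryTheory MvPolynomial

noncomputable section

namespace SerrePaper

/-! ### Simplicial complexes (given by their sets of faces) -/

variable {V : Type}

/-- A (nonempty, downward closed) abstract simplicial complex, given by its set of faces. -/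
def IsComplex (K : Set (Finset V)) : Prop :=
  K.Nonempty ∧ ∀ F ∈ K, ∀ G ⊆ F, G ∈ K

/-- `F` is a facet (maximal face) of `K`. -/
def IsFacet (K : Set (Finset V)) (F : Finset V) : Prop :=
  F ∈ K ∧ ∀ G ∈ K, F ⊆ G → G = F

/-- `K` is pure: all facets have the same cardinality. -/
def Pure (K : Set (Finset V)) : Prop :=
  ∀ F G : Finset V, IsFacet K F → IsFacet K G → F.card = G.card

/-- `dim K = d - 1`, i.e. the maximal cardinality of a face of `K` is `d`. -/
def HasDimCard (K : Set (Finset V)) (d : ℕ) : Prop :=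
  (∃ F ∈ K, F.card = d) ∧ ∀ F ∈ K, F.card ≤ d

/-- the link of the face `F` in `K`. -/
def link [DecidableEq V] (K : Set (Finset V)) (F : Finset V) : Set (Finset V) :=
  { G | G ∪ F ∈ K ∧ G ∩ F = ∅ }

/-- `skeleton K t` is the `(t-1)`-skeleton `K^{t-1}` of `K`:
all faces with at most `t` vertices. -/
def skeleton (K : Set (Finset V)) (t : ℕ) : Set (Finset V) :=
  { F ∈ K | F.card ≤ t }

/-- The Alexander dual complex `K^∨ = { F | complement of F is not a face of K }`. -/
def dualComplex [Fintype V] [DecidableEq V] (K : Set (Finset V)) : Set (Finset V) :=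
  { F | Fᶜ ∉ K }

/-- The copy of `K` on its own vertex set (as a complex on the corresponding subtype). -/
def restrictVerts (K : Set (Finset V)) : Set (Finset {v : V // {v} ∈ K}) :=
  { F | F.map (Function.Embedding.subtype _) ∈ K }

/-- The induced subcomplex `K_W` on a subset `W` of the vertices. -/
def inducedSub (K : Set (Finset V)) (W : Finset V) : Set (Finset V) :=
  { F ∈ K | F ⊆ W }

/-- `K` is a matroid complex: every induced subcomplex is pure. -/
def IsMatroidComplex (K : Set (Finset V)) : Prop :=
  ∀ W : Finset V, Pure (inducedSub K W)

/-! ### Reduced simplicial homology with coefficients in a field `k` -/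

/-- The group of simplicial `(c-1)`-chains: formal `k`-linear combinations of the
faces of `K` with exactly `c` vertices. -/
abbrev chainGroup (k : Type) [Field k] (K : Set (Finset V)) (c : ℕ) : Type :=
  {F : Finset V // F ∈ K ∧ F.card = c} →₀ k

open Classical in
/-- the boundary of a single face, `∂F = ∑_{x ∈ F} (-1)^{pos of x in F} (F \ {x})`. -/
def boundaryAt (k : Type) [Field k] [LinearOrder V] (K : Set (Finset V)) (c : ℕ)
    (F : {F : Finset V // F ∈ K ∧ F.card = c + 1}) : chainGroup k K c :=
  ∑ x ∈ F.1.attach,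
    if h : F.1.erase x.1 ∈ K then
      Finsupp.single
        ⟨F.1.erase x.1, h, by simp [Finset.card_erase_of_mem x.2, F.2.2]⟩
        ((-1 : k) ^ (F.1.filter (fun y => y < x.1)).card)
    else 0

/-- The simplicial boundary map (for a downward closed `K` this is the usual
boundary map of the reduced (augmented) chain complex of `K`, where faces with
`c` vertices sit in homological degree `c - 1`). -/
def boundary (k : Type) [Field k] [LinearOrder V] (K : Set (Finset V)) (c : ℕ) :
    chainGroup k K (c + 1) →ₗ[k] chainGroup k K c :=
  Finsupp.lsum k fun F => LinearMap.toSpanSingleton k _ (boundaryAt k K c F)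

/-- `H̃ᵢ(K; k) = 0`: every reduced `i`-cycle is a boundary.  (For `i ≤ -2` this holds
trivially; for `i = -1` the relevant cycle group is the whole of the `(-1)`-chains.) -/
def reducedHomologyVanishes (k : Type) [Field k] [LinearOrder V]
    (K : Set (Finset V)) (i : ℤ) : Prop :=
  if i < -1 then True
  else if i = -1 then
    ∀ z : chainGroup k K 0, ∃ b : chainGroup k K 1, boundary k K 0 b = z
  else
    ∀ z : chainGroup k K (i.toNat + 1), boundary k K i.toNat z = 0 →
      ∃ b : chainGroup k K (i.toNat + 2), boundary k K (i.toNat + 1) b = z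

/-- Nonvanishing `β_{i,j}(k[K]) ≠ 0` of the graded Betti numbers of the
Stanley–Reisner ring of `K`, expressed via Hochster's formula:
`β_{i,j}(k[K]) = ∑_{W ⊆ V, |W| = j} dim_k H̃_{j-i-1}(K_W; k)`. -/
def bettiNonzero (k : Type) [Field k] [LinearOrder V] (K : Set (Finset V)) (i j : ℕ) : Prop :=
  ∃ W : Finset V, W.card = j ∧
    ¬ reducedHomologyVanishes k (inducedSub K W) ((j : ℤ) - i - 1)

/-- `reg_{≤ r} I_K = max{ j : β_{i,i+j}(I_K) ≠ 0 for some i ≤ r }`, where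
`β_{i,d}(I_K) = β_{i+1,d}(k[K])`. -/
def regLEIdeal (k : Type) [Field k] [LinearOrder V] (K : Set (Finset V)) (r : ℕ) : ℕ :=
  sSup { j : ℕ | ∃ i ≤ r, bettiNonzero k K (i + 1) (i + j) }

/-- `indeg I_K`: the least degree of a minimal generator of the Stanley–Reisner
ideal of `K`, i.e. `min{ j : β_{0,j}(I_K) = β_{1,j}(k[K]) ≠ 0 }`. -/
def indegIdeal (k : Type) [Field k] [LinearOrder V] (K : Set (Finset V)) : ℕ :=
  sInf { j : ℕ | bettiNonzero k K 1 j }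

/-! ### Stanley–Reisner rings, Serre depth, depth, symbolic powers -/

variable (k : Type) [Field k]

/-- The Stanley–Reisner ideal of `K` (generated by the monomials of the non-faces,
equivalently by those of the minimal non-faces). -/
def srIdeal (K : Set (Finset V)) : Ideal (MvPolynomial V k) :=
  Ideal.span { m | ∃ F : Finset V, F ∉ K ∧ m = ∏ i ∈ F, X i }

/-- The homogeneous maximal ideal `(x_v : v ∈ V)` of the polynomial ring. -/
def maxIdeal (V : Type) : Ideal (MvPolynomial V k) :=
  Ideal.span (Set.range X)

/-- The quotient ring `S/I` as an object of `ModuleCat S`. -/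
def quotMod {V : Type} (I : Ideal (MvPolynomial V k)) : ModuleCat (MvPolynomial V k) :=
  ModuleCat.of _ (MvPolynomial V k ⧸ I)

/-- The Stanley–Reisner ring `k[K] = S/I_K` as a module over `S`. -/
def srRing (K : Set (Finset V)) : ModuleCat (MvPolynomial V k) :=
  quotMod k (srIdeal k K)

/-- The Krull dimension of a module, `dim M = dim (R / ann M)` (so `dim 0 = ⊥ = -∞`). -/
def modDim {R : Type} [CommRing R] (M : ModuleCat R) : WithBot ℕ∞ :=
  ringKrullDim (R ⧸ Module.annihilator R M)

/-- `Ext_R^i(M, N)` as an `R`-module. -/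
def extM {R : Type} [CommRing R] (M N : ModuleCat R) (i : ℕ) : ModuleCat R :=
  ((Ext R (ModuleCat R) i).obj (Opposite.op M)).obj N

/-- `K_M^j = Ext_S^{n-j}(M, ω_S)`, the (Matlis dual of) local cohomology; since the
canonical module `ω_S` of the polynomial ring `S` is `S` itself up to a
grading shift, we use `Ext_S^{n-j}(M, S)`. -/
def serreK {V : Type} (M : ModuleCat (MvPolynomial V k)) (j : ℕ) :
    ModuleCat (MvPolynomial V k) :=
  extM M (ModuleCat.of _ (MvPolynomial V k)) (Nat.card V - j)

/-- The Serre depth `S_r-depth(M) = min{ j : dim K_M^j ≥ j - r + 1 }`.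
(Note that, since `dim K_M^j` is either `⊥` or `≥ 0`, the inequality
`dim K_M^j ≥ j - r + 1` of (possibly negative) integers is equivalent to
`(j + 1 - r : ℕ) ≤ dim K_M^j` with truncated subtraction.) -/
def serreDepth {V : Type} (r : ℕ) (M : ModuleCat (MvPolynomial V k)) : ℕ :=
  sInf { j : ℕ | ((j + 1 - r : ℕ) : WithBot ℕ∞) ≤ modDim (serreK k M j) }

/-- Serre's condition `(S_r)` for an unmixed module: `S_r-depth(M) = dim M`. -/
def serreCond {V : Type} (r : ℕ) (M : ModuleCat (MvPolynomial V k)) : Prop :=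
  (serreDepth k r M : WithBot ℕ∞) = modDim M

/-- The depth of `M` with respect to the homogeneous maximal ideal,
via Rees' characterization `depth M = min{ i : Ext^i(S/m, M) ≠ 0 }`. -/
def mdepth {V : Type} (M : ModuleCat (MvPolynomial V k)) : ℕ :=
  sInf { i : ℕ | Nontrivial (extM (quotMod k (maxIdeal k V)) M i) }

/-- `M` is Cohen–Macaulay: `depth M = dim M`. -/
def isCM {V : Type} (M : ModuleCat (MvPolynomial V k)) : Prop :=
  (mdepth k M : WithBot ℕ∞) = modDim M

/-- The `ℓ`-th symbolic power of a (radical, e.g. squarefree monomial) ideal: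
`I^(ℓ) = ⋂_{P ∈ Min(I)} P^ℓ`. -/
def symbPow {R : Type} [CommRing R] (I : Ideal R) (ℓ : ℕ) : Ideal R :=
  sInf { J | ∃ P ∈ I.minimalPrimes, J = P ^ ℓ }

/-- The height of an ideal: the Krull dimension of the poset of primes contained in it. -/
def idealHeight {R : Type} [CommRing R] (p : Ideal R) : WithBot ℕ∞ :=
  Order.krullDim { q : PrimeSpectrum R // q.asIdeal ≤ p }

/-- `R/I` is unmixed: all associated primes of `R/I` have the same height. -/
def IsUnmixedIdeal {R : Type} [CommRing R] (I : Ideal R) : Prop :=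
  ∀ p q : Ideal R, p ∈ associatedPrimes R (R ⧸ I) → q ∈ associatedPrimes R (R ⧸ I) →
    idealHeight p = idealHeight q

/-- Nonvanishing of the first local cohomology `H_m^1(S/I) ≠ 0`. -/
def H1NE {V : Type} (I : Ideal (MvPolynomial V k)) : Prop :=
  Nontrivial ((localCohomology (maxIdeal k V) 1).obj (quotMod k I))

/-- `I` is a squarefree monomial ideal. -/
def IsSqFreeMonomialIdeal {V : Type} (I : Ideal (MvPolynomial V k)) : Prop :=
  ∃ G : Set (Finset V), I = Ideal.span ((fun F => ∏ i ∈ F, X i) '' G)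

end SerrePaper

end
namespace SerrePaper

section Homological
variable {R : Type} [CommRing R]

theorem mem_annihilator_homology_iff {ι : Type*} {c : ComplexShape ι}
    (K : HomologicalComplex (ModuleCat R) c) (i : ι) (a : R) :
    a ∈ Module.annihilator R (K.homology i) ↔
      ∀ x : K.X i, K.d i (c.next i) x = 0 → ∃ y : K.X (c.prev i), K.d (c.prev i) i y = a • x := by
  have e : K.homology i ≃ₗ[R] (LinearMap.ker (K.sc i).g.hom ⧸
      LinearMap.range (K.sc i).moduleCatToCycles) := (K.sc i).moduleCatHomologyIso.toLinearEquiv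
  rw [e.annihilator_eq, Module.mem_annihilator]
  constructor
  · intro h x hx
    have := h (Submodule.Quotient.mk ⟨x, hx⟩)
    rw [← Submodule.Quotient.mk_smul] at this
    obtain ⟨y, hy⟩ := (Submodule.Quotient.mk_eq_zero _).1 this
    exact ⟨y, congrArg Subtype.val hy⟩
  · intro h m
    obtain ⟨⟨x, hx⟩, rfl⟩ := Submodule.Quotient.mk_surjective _ m
    obtain ⟨y, hy⟩ := h x hx
    rw [← Submodule.Quotient.mk_smul]
    exact (Submodule.Quotient.mk_eq_zero _).2 ⟨y, Subtype.ext hy⟩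

/-- `a` annihilates the `i`-th cohomology of `Hom(P, N)`. -/
def KillsCohomology (P : ChainComplex (ModuleCat R) ℕ) (N : ModuleCat R) (i : ℕ) (a : R) : Prop :=
  ∀ f : P.X i ⟶ N, P.d (i + 1) i ≫ f = 0 → ∃ g : P.X (i - 1) ⟶ N, P.d i (i - 1) ≫ g = a • f

theorem mem_annihilator_ext_iff {M : ModuleCat R} (P : ProjectiveResolution M) (N : ModuleCat R)
    (i : ℕ) (a : R) :
    a ∈ Module.annihilator R (((Ext R (ModuleCat R) i).obj (Opposite.op M)).obj N) ↔
      KillsCohomology P.complex N i a := by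
  rw [LinearEquiv.annihilator_eq (P.isoExt i N).toLinearEquiv, mem_annihilator_homology_iff]
  have hn : (ComplexShape.up ℕ).next i = i + 1 := by simp
  have hp : (ComplexShape.up ℕ).prev i = i - 1 := by cases i <;> simp
  rw [hn, hp]
  rfl

theorem KillsCohomology.of_homotopy {P Q : ChainComplex (ModuleCat R) ℕ} {N : ModuleCat R}
    {i : ℕ} {a w : R} (h : KillsCohomology Q N i a) (U : P ⟶ Q) (V : Q ⟶ P)
    (H : Homotopy (U ≫ V) (w • 𝟙 P)) : KillsCohomology P N i (a * w) := by
  intro f hf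
  obtain ⟨g, hg⟩ := h (V.f i ≫ f) (by rw [← V.comm_assoc, hf, Limits.comp_zero])
  have hH := H.comm i
  have hcomp : (U ≫ V).f i ≫ f = P.d i (i - 1) ≫ H.hom (i - 1) i ≫ f + w • f := by
    rw [hH, dNext_nat, Homotopy.prevD_chainComplex, Preadditive.add_comp, Preadditive.add_comp]
    simp [hf]
  refine ⟨U.f (i - 1) ≫ g - a • H.hom (i - 1) i ≫ f, ?_⟩
  rw [Preadditive.comp_sub, ← U.comm_assoc, hg, Linear.comp_smul, Linear.comp_smul,
    ← Category.assoc, ← HomologicalComplex.comp_f, hcomp, smul_add, mul_smul]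
  abel

theorem KillsCohomology.of_homotopy_zero {P : ChainComplex (ModuleCat R) ℕ} {N : ModuleCat R}
    {i : ℕ} {w : R} (H : Homotopy (w • 𝟙 P) 0) : KillsCohomology P N i w := by
  intro f hf
  have hH : w • 𝟙 _ = P.d i (i - 1) ≫ H.hom (i - 1) i + H.hom i (i + 1) ≫ P.d (i + 1) i := by
    have := H.comm i
    rw [dNext_nat, Homotopy.prevD_chainComplex] at this
    simpa using this
  refine ⟨H.hom (i - 1) i ≫ f, ?_⟩
  rw [← Category.id_comp f, ← Linear.smul_comp, hH]
  simp [hf]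

/-- If `w` factors through `M'` as an endomorphism of `M`, then annihilators of `Ext(M', N)`
annihilate `Ext(M, N)` up to the factor `w`. -/
theorem mul_mem_annihilator_ext {M M' N : ModuleCat R} {i : ℕ} {a w : R}
    (u : M ⟶ M') (v : M' ⟶ M) (huv : u ≫ v = w • 𝟙 M)
    (h : a ∈ Module.annihilator R (((Ext R (ModuleCat R) i).obj (Opposite.op M')).obj N)) :
    a * w ∈ Module.annihilator R (((Ext R (ModuleCat R) i).obj (Opposite.op M)).obj N) := by
  let P := projectiveResolution M
  let Q := projectiveResolution M'
  rw [mem_annihilator_ext_iff Q] at h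
  rw [mem_annihilator_ext_iff P]
  refine h.of_homotopy (ProjectiveResolution.lift u P Q) (ProjectiveResolution.lift v Q P) ?_
  refine ProjectiveResolution.liftHomotopy (u ≫ v) _ _ ?_ ?_
  · simp
  · ext : 1
    simp only [HomologicalComplex.comp_f, huv, HomologicalComplex.smul_f_apply, Linear.smul_comp,
      Category.id_comp]
    rfl

theorem killsCohomology_of_mem_annihilator {M N : ModuleCat R} (P : ProjectiveResolution M)
    {i : ℕ} {w : R} (h : w ∈ Module.annihilator R M) : KillsCohomology P.complex N i w := by
  refine .of_homotopy_zero (ProjectiveResolution.liftHomotopyZero (Q := P) _ ?_)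
  ext x
  exact (congrArg (P.π.f 0) (rfl : _ = w • x)).trans
    (((P.π.f 0).hom.map_smul w x).trans (Module.mem_annihilator.1 h _))

/-- Cohomology of `Hom(P, -)` along a short exact sequence `0 ⟶ L ⟶ L ⟶ L' ⟶ 0` whose first map
is multiplication by `x`, where `x` is homotopic to zero on `P`. -/
theorem KillsCohomology.vanish_of_quotient {P : ChainComplex (ModuleCat R) ℕ}
    [∀ i, Projective (P.X i)] {L L' : ModuleCat R} {x : R} (p : L ⟶ L') [Epi p]
    (hxp : x • p = 0)
    (hp : ∀ {Q : ModuleCat R} (g : Q ⟶ L), g ≫ p = 0 → ∃ h : Q ⟶ L, g = x • h)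
    (hx : ∀ {Q : ModuleCat R} (g : Q ⟶ L), x • g = 0 → g = 0)
    {i : ℕ} (hL : KillsCohomology P L i x) (hL' : ∀ j, j + 1 = i → KillsCohomology P L' j 1) :
    KillsCohomology P L i 1 := by
  intro f hf
  obtain ⟨g, hg⟩ := hL f hf
  cases i with
  | zero =>
    refine ⟨0, ?_⟩
    simp at hg
    rw [hx f hg.symm]; simp
  | succ i =>
    obtain ⟨g, hg⟩ : ∃ g : P.X i ⟶ L, P.d (i + 1) i ≫ g = x • f := ⟨g, hg⟩
    change ∃ g : P.X i ⟶ L, P.d (i + 1) i ≫ g = _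
    obtain ⟨v, hv⟩ := hL' i rfl (g ≫ p) (by rw [reassoc_of% hg]; simp [← Linear.comp_smul, hxp])
    obtain ⟨v, rfl⟩ := Projective.factors v p
    obtain ⟨w, hw⟩ := hp (g - P.d i (i - 1) ≫ v)
      (by simpa [Preadditive.sub_comp, sub_eq_zero] using hv.symm)
    refine ⟨w, ?_⟩
    rw [one_smul, ← sub_eq_zero]
    apply hx
    rw [smul_sub, ← hg, ← Linear.comp_smul, ← hw]
    simp

theorem KillsCohomology.of_quotient {P : ChainComplex (ModuleCat R) ℕ}
    [∀ i, Projective (P.X i)] {L L' : ModuleCat R} {x a : R} (p : L ⟶ L') [Epi p]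
    (hxp : x • p = 0)
    (hp : ∀ {Q : ModuleCat R} (g : Q ⟶ L), g ≫ p = 0 → ∃ h : Q ⟶ L, g = x • h)
    (hx : ∀ {Q : ModuleCat R} (g : Q ⟶ L), x • g = 0 → g = 0)
    {i : ℕ} (hL : KillsCohomology P L i 1) (h : KillsCohomology P L (i + 1) a) :
    KillsCohomology P L' i a := by
  intro f hf
  obtain ⟨f, rfl⟩ := Projective.factors f p
  obtain ⟨g, hg⟩ := hp (P.d (i + 1) i ≫ f) (by simpa using hf)
  obtain ⟨u, hu⟩ : ∃ u : P.X i ⟶ L, P.d (i + 1) i ≫ u = a • g :=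
    h g (hx _ (by rw [← Linear.comp_smul, ← hg]; simp))
  obtain ⟨v, hv⟩ := hL (a • f - x • u) (by
    rw [Preadditive.comp_sub, Linear.comp_smul, Linear.comp_smul, hg, hu, smul_comm, sub_self])
  refine ⟨v ≫ p, ?_⟩
  rw [reassoc_of% hv]
  simp [Preadditive.sub_comp, ← Linear.comp_smul, hxp]

end Homological

section Dimension

theorem ringKrullDim_le_of_injective_of_isIntegral {R T : Type*} [CommRing R] [CommRing T]
    (f : R →+* T) (hinj : Function.Injective f) (hint : f.IsIntegral) :
    ringKrullDim R ≤ ringKrullDim T := by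
  algebraize [f]
  refine iSup_le fun l ↦ ?_
  obtain ⟨Q, -, _, hQ⟩ := Ideal.exists_ideal_over_prime_of_isIntegral (S := T)
    l.head.asIdeal ⊥ (by
      exact ((RingHom.injective_iff_ker_eq_bot f).1 hinj).le.trans bot_le)
  have : Q.LiesOver l.head.asIdeal := ⟨hQ.symm⟩
  obtain ⟨L, hL, -⟩ := Ideal.exists_ltSeries_of_hasGoingUp l Q
  rw [← hL]
  exact le_iSup (fun p : LTSeries (PrimeSpectrum T) ↦ (p.length : WithBot ℕ∞)) L

theorem ringKrullDim_quotient_comap_le {R T : Type*} [CommRing R] [CommRing T]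
    (f : R →+* T) (hint : f.IsIntegral) (J : Ideal T) :
    ringKrullDim (R ⧸ J.comap f) ≤ ringKrullDim (T ⧸ J) :=
  ringKrullDim_le_of_injective_of_isIntegral (Ideal.quotientMap J f le_rfl)
    Ideal.quotientMap_injective hint.quotient
end Dimension

section Trace

/-- A trace form `T → R` along `f : R →+* T` together with dual generating families of `T`. -/
structure TraceData {R T : Type} [CommRing R] [CommRing T] (f : R →+* T) (ι : Type) [Fintype ι]
    where
  trace : T →+ R
  trace_mul : ∀ r t, trace (f r * t) = r * trace t
  gen : ι → T
  dual : ι → T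
  sum_eq : ∀ t, ∑ i, f (trace (t * dual i)) * gen i = t

namespace TraceData

variable {R T : Type} [CommRing R] [CommRing T] {f : R →+* T} {ι : Type} [Fintype ι]
  (D : TraceData f ι)

include D

theorem eq_of_trace_mul_eq {s t : T} (h : ∀ a, D.trace (a * s) = D.trace (a * t)) : s = t := by
  rw [← D.sum_eq s, ← D.sum_eq t]
  simp only [mul_comm _ (D.dual _), h]

theorem projective :
    Module.Projective R ((ModuleCat.restrictScalars f).obj (ModuleCat.of T T)) := by
  let T' := (ModuleCat.restrictScalars f).obj (ModuleCat.of T T)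
  let u : T' →ₗ[R] (ι → R) :=
    { toFun := fun (t : T) i ↦ D.trace (t * D.dual i)
      map_add' := fun (s t : T) ↦ by
        ext i
        exact (congrArg D.trace (add_mul s t _)).trans (map_add _ _ _)
      map_smul' := fun r (t : T) ↦ by
        ext i
        exact (congrArg D.trace (mul_assoc _ _ _)).trans (D.trace_mul _ _) }
  let v : (ι → R) →ₗ[R] T' :=
    { toFun := fun r ↦ (∑ i, f (r i) * D.gen i : T)
      map_add' := fun r s ↦ by
        change (∑ i, f (r i + s i) * D.gen i : T) =
          (∑ i, f (r i) * D.gen i) + ∑ i, f (s i) * D.gen i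
        simp [add_mul, Finset.sum_add_distrib]
      map_smul' := fun a r ↦ by
        change (∑ i, f (a * r i) * D.gen i : T) = f a * ∑ i, f (r i) * D.gen i
        simp [mul_assoc, Finset.mul_sum] }
  exact Module.Projective.of_split u v (LinearMap.ext D.sum_eq)

theorem isIntegral : f.IsIntegral := by
  algebraize [f]
  have : Module.Finite R T := .of_surjective
    (Fintype.linearCombination R D.gen) fun t ↦ ⟨fun i ↦ D.trace (t * D.dual i), by
      simp only [Fintype.linearCombination_apply, Algebra.smul_def]; exact D.sum_eq t⟩
  exact fun t ↦ Algebra.IsIntegral.isIntegral (R := R) t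

theorem preservesProjectiveObjects :
    (ModuleCat.restrictScalars.{0} f).PreservesProjectiveObjects where
  projective_obj {M} hM := by
    have := D.projective
    have : (ModuleCat.coextendScalars.{0} f).PreservesEpimorphisms := ⟨fun {X Y} g hg ↦ by
      rw [ModuleCat.epi_iff_surjective] at hg ⊢
      intro h
      obtain ⟨h', hh⟩ := Module.projective_lifting_property g.hom h hg
      exact ⟨h', hh⟩⟩
    exact (ModuleCat.restrictCoextendScalarsAdj f).map_projective M hM

/-- The `T`-linear map corresponding to an `R`-linear form on a `T`-module. -/
noncomputable def lift {M : ModuleCat T}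
    (α : (ModuleCat.restrictScalars f).obj M ⟶ ModuleCat.of R R) (p : M) : T :=
  ∑ i, f (α (D.gen i • p : M)) * D.dual i

theorem trace_mul_lift {M : ModuleCat T}
    (α : (ModuleCat.restrictScalars f).obj M ⟶ ModuleCat.of R R) (t : T) (p : M) :
    D.trace (t * D.lift α p) = α (t • p : M) := by
  conv_rhs => rw [← D.sum_eq t, Finset.sum_smul]
  erw [map_sum α.hom]
  rw [lift, Finset.mul_sum, map_sum]
  refine Finset.sum_congr rfl fun i _ ↦ ?_
  rw [mul_left_comm, D.trace_mul, mul_smul, mul_comm]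
  exact (α.hom.map_smul (D.trace (t * D.dual i)) (D.gen i • p : M)).symm

theorem trace_lift {M : ModuleCat T}
    (α : (ModuleCat.restrictScalars f).obj M ⟶ ModuleCat.of R R) (p : M) :
    D.trace (D.lift α p) = α p := by
  rw [← one_mul (D.lift α p), trace_mul_lift]
  exact congrArg α (one_smul T p)

/-- Duality along `f`: if `f r` annihilates `Ext_T(M, T)`, then `r` annihilates `Ext_R(M, R)`. -/
theorem mem_annihilator_ext (M : ModuleCat T) (i : ℕ) (r : R)
    (h : f r ∈ Module.annihilator T
      (((Ext T (ModuleCat T) i).obj (Opposite.op M)).obj (ModuleCat.of T T))) :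
    r ∈ Module.annihilator R (((Ext R (ModuleCat R) i).obj
      (Opposite.op ((ModuleCat.restrictScalars f).obj M))).obj (ModuleCat.of R R)) := by
  have := D.preservesProjectiveObjects
  let P := projectiveResolution M
  rw [mem_annihilator_ext_iff P] at h
  rw [mem_annihilator_ext_iff ((ModuleCat.restrictScalars f).mapProjectiveResolution P)]
  intro α hα
  change (ModuleCat.restrictScalars f).obj (P.complex.X i) ⟶ ModuleCat.of R R at α
  let β : P.complex.X i ⟶ ModuleCat.of T T := ModuleCat.ofHom
    { toFun := D.lift α
      map_add' := fun p q ↦ D.eq_of_trace_mul_eq fun a ↦ by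
        rw [mul_add, map_add]
        simp only [D.trace_mul_lift, smul_add]
        exact α.hom.map_add _ _
      map_smul' := fun t p ↦ D.eq_of_trace_mul_eq fun a ↦ by
        rw [RingHom.id_apply, smul_eq_mul, ← mul_assoc, D.trace_mul_lift, D.trace_mul_lift,
          mul_smul] }
  obtain ⟨g, hg⟩ := h β (by
    ext p
    refine D.eq_of_trace_mul_eq fun a ↦ ?_
    refine (D.trace_mul_lift α a _).trans ?_
    rw [← map_smul]
    refine (congr($hα (a • p)) : _).trans ?_
    exact (map_zero D.trace).symm.trans (congrArg D.trace (mul_zero a).symm))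
  refine ⟨ModuleCat.ofHom (X := (ModuleCat.restrictScalars f).obj (P.complex.X (i - 1)))
    { toFun := fun p ↦ D.trace (g p)
      map_add' := fun p q ↦ (congrArg D.trace (g.hom.map_add p q)).trans (map_add _ _ _)
      map_smul' := fun a p ↦
        (congrArg D.trace (g.hom.map_smul (f a) p)).trans (D.trace_mul _ _) }, ?_⟩
  ext p
  have := congr(D.trace ($hg p))
  refine this.trans ?_
  refine (D.trace_mul r _).trans ?_
  refine congrArg (r * ·) ?_
  exact D.trace_lift (M := P.complex.X i) α p

end TraceData
end Trace

section Retract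
variable {R T : Type} [CommRing R] [CommRing T] {f : R →+* T}

/-- A quotient of `R` is a retract of a quotient of `T`, given compatible ideals and an `R`-linear
map `π : T → R` fixing `1`. -/
theorem exists_retract (π : T →+ R) (hπ : ∀ r t, π (f r * t) = r * π t) (hone : π 1 = 1)
    {I : Ideal R} {J : Ideal T} (hf : I ≤ J.comap f) (hJ : ∀ t ∈ J, π t ∈ I) :
    ∃ (u : ModuleCat.of R (R ⧸ I) ⟶ (ModuleCat.restrictScalars f).obj (ModuleCat.of T (T ⧸ J)))
      (v : (ModuleCat.restrictScalars f).obj (ModuleCat.of T (T ⧸ J)) ⟶ ModuleCat.of R (R ⧸ I)),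
      u ≫ v = (1 : R) • 𝟙 _ := by
  let vv : T ⧸ J →+ R ⧸ I := QuotientAddGroup.map J.toAddSubgroup I.toAddSubgroup π hJ
  refine ⟨ModuleCat.ofHom (Y := (ModuleCat.restrictScalars f).obj (ModuleCat.of T (T ⧸ J)))
    { toFun := Ideal.quotientMap J f hf
      map_add' := fun x y ↦ map_add _ x y
      map_smul' := fun r x ↦ ?_ },
    ModuleCat.ofHom (X := (ModuleCat.restrictScalars f).obj (ModuleCat.of T (T ⧸ J)))
    { toFun := vv
      map_add' := fun x y ↦ map_add vv x y
      map_smul' := fun r x ↦ ?_ }, ?_⟩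
  · obtain ⟨x, rfl⟩ := Ideal.Quotient.mk_surjective x
    exact congrArg (Ideal.Quotient.mk J) (map_mul f r x)
  · obtain ⟨x, rfl⟩ := Ideal.Quotient.mk_surjective (I := J) x
    exact congrArg (Ideal.Quotient.mk I) (hπ r x)
  · rw [one_smul]
    refine ModuleCat.hom_ext (LinearMap.ext fun x ↦ ?_)
    obtain ⟨x, rfl⟩ := Ideal.Quotient.mk_surjective x
    refine congrArg (Ideal.Quotient.mk I) (a₁ := π (f x)) (a₂ := x) ?_
    rw [← mul_one (f x), hπ, hone, mul_one]

end Retract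

section ExpandTrace

variable {σ k : Type} [Field k] {q : ℕ}

/-- The `r`-th component of a polynomial with respect to `MvPolynomial.expand q`:
the coefficient at `a` is the coefficient of the original polynomial at `q • a + r`. -/
noncomputable def expandComp (hq : q ≠ 0) (r : σ →₀ ℕ) : MvPolynomial σ k →+ MvPolynomial σ k :=
  ((basisMonomials σ k).repr.symm.toLinearMap ∘ₗ
    Finsupp.lcomapDomain (R := k) (fun a ↦ q • a + r)
      (fun _ _ h ↦ nsmul_right_injective hq (add_right_cancel h)) ∘ₗ
    (basisMonomials σ k).repr.toLinearMap).toAddMonoidHom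

theorem coeff_expandComp (hq : q ≠ 0) (r a : σ →₀ ℕ) (t : MvPolynomial σ k) :
    coeff a (expandComp hq r t) = coeff (q • a + r) t := rfl

theorem expandComp_mul (hq : q ≠ 0) {r : σ →₀ ℕ} (hr : ∀ i, r i < q) (s t : MvPolynomial σ k) :
    expandComp hq r (expand q s * t) = s * expandComp hq r t := by
  induction s using MvPolynomial.induction_on' with
  | add s s' h h' => rw [map_add, add_mul, map_add, h, h', add_mul]
  | monomial m c =>
    ext a
    rw [expand_monomial, coeff_expandComp, coeff_monomial_mul', coeff_monomial_mul',
      coeff_expandComp]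
    have key : q • m ≤ q • a + r ↔ m ≤ a := by
      simp only [Finsupp.le_def, Finsupp.add_apply, Finsupp.smul_apply, smul_eq_mul]
      refine forall_congr' fun i ↦ ⟨fun h ↦ ?_, fun h ↦ ?_⟩
      · have := hr i
        by_contra! hlt
        have := Nat.mul_le_mul_left q (Nat.succ_le_of_lt hlt)
        rw [Nat.succ_eq_add_one, mul_add] at this
        omega
      · exact (Nat.mul_le_mul_left q h).trans (Nat.le_add_right _ _)
    simp only [key]
    split_ifs with h
    · congr 2
      ext i
      have := Nat.mul_le_mul_left q (h i)
      simp [Nat.mul_sub]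
      omega
    · rfl

theorem expandComp_zero_one (hq : q ≠ 0) : expandComp (σ := σ) (k := k) hq 0 1 = 1 := by
  ext a
  simpa [coeff_expandComp] using coeff_expand_smul q hq (1 : MvPolynomial σ k) a

/-- The exponent vector of a function to `Fin q`. -/
noncomputable def finExponent [Fintype σ] (r : σ → Fin q) : σ →₀ ℕ :=
  Finsupp.equivFunOnFinite.symm fun i ↦ r i

@[simp]
theorem finExponent_apply [Fintype σ] (r : σ → Fin q) (i : σ) : finExponent r i = r i := rfl

theorem sum_expandComp [Fintype σ] [DecidableEq σ] (hq : q ≠ 0) (t : MvPolynomial σ k) :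
    ∑ r : σ → Fin q, expand q (expandComp hq (finExponent r) t) *
      monomial (finExponent r) 1 = t := by
  ext b
  rw [coeff_sum]
  simp only [coeff_mul_monomial', mul_one]
  let r₀ : σ → Fin q := fun i ↦ ⟨b i % q, Nat.mod_lt _ (Nat.pos_of_ne_zero hq)⟩
  have hr₀ : finExponent r₀ ≤ b := fun i ↦ Nat.mod_le _ _
  have hb : b - finExponent r₀ = q • (Finsupp.equivFunOnFinite.symm fun i ↦ b i / q) := by
    ext i
    have := Nat.div_add_mod (b i) q
    simp [r₀]
    omega
  rw [Finset.sum_eq_single r₀, if_pos hr₀, hb, coeff_expand_smul _ hq, coeff_expandComp, ← hb,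
    tsub_add_cancel_of_le hr₀]
  · intro r _ hr
    obtain ⟨i, hi⟩ : ∃ i, (r i : ℕ) ≠ b i % q := by
      by_contra! h
      exact hr (funext fun i ↦ Fin.ext (h i))
    split_ifs with h
    · have hri : (r i : ℕ) ≤ b i := h i
      have hd : ¬ q ∣ (b - finExponent r) i := fun hd ↦ hi <| by
        rw [← (Nat.modEq_iff_dvd' hri).2 hd, Nat.mod_eq_of_lt (r i).2]
      exact coeff_expand_of_not_dvd _ hd
    · rfl
  · simp

theorem expandComp_mul_monomial (hq : q ≠ 0) (r s : σ →₀ ℕ) (t : MvPolynomial σ k) :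
    expandComp hq (r + s) (t * monomial s 1) = expandComp hq r t := by
  ext a
  rw [coeff_expandComp, ← add_assoc, coeff_mul_monomial, mul_one, coeff_expandComp]

/-- `MvPolynomial.expand q` has a trace form, given by the top component. -/
noncomputable def expandTraceData [Fintype σ] [DecidableEq σ] (hq : q ≠ 0) :
    TraceData (expand q : MvPolynomial σ k →ₐ[k] MvPolynomial σ k).toRingHom (σ → Fin q) where
  trace := expandComp hq (Finsupp.equivFunOnFinite.symm fun _ ↦ q - 1)
  trace_mul := expandComp_mul hq fun i ↦ Nat.sub_one_lt hq
  gen r := monomial (finExponent r) 1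
  dual r := monomial (finExponent fun i ↦ (r i).rev) 1
  sum_eq t := by
    refine .trans (Finset.sum_congr rfl fun r _ ↦ ?_) (sum_expandComp hq t)
    rw [← expandComp_mul_monomial hq (finExponent r) (finExponent fun i ↦ (r i).rev)]
    have hr : finExponent r + finExponent (fun i ↦ (r i).rev) =
        Finsupp.equivFunOnFinite.symm fun _ ↦ q - 1 := by
      ext i
      have := (r i).2
      simp [Fin.val_rev]
      omega
    rw [hr]
    rfl

end ExpandTrace

section VarIdeal

variable {σ : Type} (k : Type) [Field k]

/-- The ideal generated by the variables indexed by `s`. -/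
noncomputable def varIdeal (s : Finset σ) : Ideal (MvPolynomial σ k) :=
  Ideal.span (X '' (s : Set σ))

variable {k}

theorem X_mem_varIdeal_iff {s : Finset σ} {i : σ} : X i ∈ varIdeal k s ↔ i ∈ s := by
  refine ⟨fun h ↦ ?_, fun h ↦ Ideal.subset_span ⟨i, h, rfl⟩⟩
  classical
  obtain ⟨j, hj, hij⟩ := mem_ideal_span_X_image.1 h (Finsupp.single i 1) (by simp [support_X])
  rw [Finsupp.single_apply_ne_zero] at hij
  exact hij.1 ▸ hj

theorem mem_varIdeal_pow_iff {s : Finset σ} {a : ℕ} {t : MvPolynomial σ k} :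
    t ∈ varIdeal k s ^ a ↔ ∀ m, coeff m t ≠ 0 → a ≤ ∑ i ∈ s, m i := by
  classical
  constructor
  · induction a generalizing t with
    | zero => simp
    | succ a ih =>
      intro h
      rw [pow_succ] at h
      induction h using Submodule.mul_induction_on' with
      | mem_mul_mem u hu v hv =>
        intro m hm
        obtain ⟨b, hb, c, hc, rfl⟩ := Finset.mem_add.1 (support_mul u v (mem_support_iff.2 hm))
        obtain ⟨i, hi, hci⟩ := mem_ideal_span_X_image.1 hv c hc
        have h1 := ih hu b (mem_support_iff.1 hb)
        have h2 : c i ≤ ∑ i ∈ s, c i := Finset.single_le_sum (fun _ _ ↦ Nat.zero_le _) hi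
        simp only [Finsupp.add_apply, Finset.sum_add_distrib]
        omega
      | add u _ v _ hu hv =>
        intro m hm
        rw [coeff_add] at hm
        by_cases h0 : coeff m u = 0
        · exact hv m (by simpa [h0] using hm)
        · exact hu m h0
  · intro h
    rw [t.as_sum]
    refine Ideal.sum_mem _ fun m hm ↦ ?_
    have hprod : ∏ i ∈ s, (X i : MvPolynomial σ k) ^ m i ∈ varIdeal k s ^ a := by
      refine Ideal.pow_le_pow_right (h m (mem_support_iff.1 hm)) ?_
      rw [← Finset.prod_pow_eq_pow_sum]
      exact Ideal.prod_mem_prod fun i hi ↦ Ideal.pow_mem_pow (X_mem_varIdeal_iff.2 hi) _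
    obtain ⟨m', hm'⟩ : ∃ m' : σ →₀ ℕ, m = m' + ∑ i ∈ s, Finsupp.single i (m i) := by
      refine ⟨m - ∑ i ∈ s, Finsupp.single i (m i), (tsub_add_cancel_of_le fun i ↦ ?_).symm⟩
      simp [Finsupp.finsetSum_apply, Finsupp.single_apply]
      split_ifs <;> simp
    have : monomial m (coeff m t) = monomial m' (coeff m t) * ∏ i ∈ s, X i ^ m i := by
      simp only [X_pow_eq_monomial, ← monomial_sum_one, monomial_mul, mul_one, ← hm']
    rw [this]
    exact Ideal.mul_mem_left _ _ hprod

theorem expand_mem_varIdeal_pow {s : Finset σ} {a b q : ℕ} (h : b ≤ q * a)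
    {t : MvPolynomial σ k} (ht : t ∈ varIdeal k s ^ a) : expand q t ∈ varIdeal k s ^ b := by
  have h1 : (varIdeal k s).map (expand q : MvPolynomial σ k →ₐ[k] _).toRingHom ≤
      varIdeal k s ^ q := by
    rw [varIdeal, Ideal.map_span, Ideal.span_le]
    rintro _ ⟨_, ⟨i, hi, rfl⟩, rfl⟩
    have : expand q (X i : MvPolynomial σ k) ∈ varIdeal k s ^ q := by
      rw [expand_X]
      exact Ideal.pow_mem_pow (X_mem_varIdeal_iff.2 hi) _
    exact this
  refine Ideal.pow_le_pow_right h ?_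
  rw [pow_mul]
  refine Ideal.pow_right_mono h1 a ?_
  rw [← Ideal.map_pow]
  exact Ideal.mem_map_of_mem _ ht

theorem expandComp_mem_varIdeal_pow {s : Finset σ} {a b q : ℕ} (hq : q ≠ 0) (h : q * a < b + q)
    {t : MvPolynomial σ k} (ht : t ∈ varIdeal k s ^ b) :
    expandComp hq 0 t ∈ varIdeal k s ^ a := by
  rw [mem_varIdeal_pow_iff] at ht ⊢
  intro m hm
  rw [coeff_expandComp, add_zero] at hm
  have := ht _ hm
  simp only [Finsupp.smul_apply, smul_eq_mul, ← Finset.mul_sum] at this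
  have h2 : q * a < q * (∑ i ∈ s, m i + 1) := by rw [mul_add]; omega
  have := Nat.lt_of_mul_lt_mul_left h2
  omega

theorem ker_killCompl_eq_varIdeal (s : Finset σ) :
    RingHom.ker (killCompl (R := k) (Subtype.val_injective (p := fun i ↦ i ∉ s))) =
      varIdeal k s := by
  classical
  refine le_antisymm (fun t ht ↦ ?_) (Ideal.span_le.2 ?_)
  · have key : (Ideal.Quotient.mkₐ k (varIdeal k s)).comp ((rename Subtype.val).comp
        (killCompl (R := k) (Subtype.val_injective (p := fun i ↦ i ∉ s)))) =
        Ideal.Quotient.mkₐ k (varIdeal k s) := by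
      ext i
      by_cases hi : i ∈ s
      · have : Ideal.Quotient.mk (varIdeal k s) (X i) = 0 :=
          Ideal.Quotient.eq_zero_iff_mem.2 (X_mem_varIdeal_iff.2 hi)
        simp [killCompl, hi, this]
      · have hX : (X i : MvPolynomial σ k) =
            rename Subtype.val (X (⟨i, hi⟩ : {i // i ∉ s}) : MvPolynomial _ k) := by simp
        rw [AlgHom.comp_apply, AlgHom.comp_apply, hX, killCompl_rename_app]
    have := DFunLike.congr_fun key t
    simp only [AlgHom.comp_apply, (RingHom.mem_ker).1 ht, map_zero] at this
    exact Ideal.Quotient.eq_zero_iff_mem.1 this.symm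
  · rintro _ ⟨i, hi, rfl⟩
    have hi : i ∈ s := hi
    simp [killCompl, RingHom.mem_ker, hi]

theorem killCompl_surjective (s : Finset σ) :
    Function.Surjective (killCompl (R := k) (Subtype.val_injective (p := fun i ↦ i ∉ s))) :=
  fun p ↦ ⟨_, killCompl_rename_app _ p⟩

instance isPrime_varIdeal (s : Finset σ) : (varIdeal k s).IsPrime := by
  rw [← ker_killCompl_eq_varIdeal]
  exact RingHom.ker_isPrime _

theorem le_ringKrullDim_quotient_varIdeal [Fintype σ] (s : Finset σ) :
    ((Fintype.card σ - s.card : ℕ) : WithBot ℕ∞) ≤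
      ringKrullDim (MvPolynomial σ k ⧸ varIdeal k s) := by
  classical
  have e := Ideal.quotientKerAlgEquivOfSurjective (killCompl_surjective (k := k) s)
  rw [← ker_killCompl_eq_varIdeal, ringKrullDim_eq_of_ringEquiv e.toRingEquiv,
    MvPolynomial.ringKrullDim_of_isNoetherianRing]
  simp

theorem exists_eq_varIdeal [Fintype σ] {K : Set (Finset σ)} {P : Ideal (MvPolynomial σ k)}
    (hP : P ∈ (srIdeal k K).minimalPrimes) : ∃ s : Finset σ, P = varIdeal k s := by
  classical
  have := hP.1.1
  refine ⟨Finset.univ.filter fun i ↦ X i ∈ P, le_antisymm (hP.2 ⟨isPrime_varIdeal _, ?_⟩ ?_) ?_⟩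
  · refine Ideal.span_le.2 ?_
    rintro _ ⟨F, hF, rfl⟩
    have h1 : ∏ i ∈ F, (X i : MvPolynomial σ k) ∈ P := hP.1.2 (Ideal.subset_span ⟨F, hF, rfl⟩)
    obtain ⟨i, hi, hiP⟩ := (Ideal.IsPrime.prod_mem_iff).1 h1
    exact Ideal.mem_of_dvd _ (Finset.dvd_prod_of_mem _ hi)
      (X_mem_varIdeal_iff.2 (by simpa using hiP))
  all_goals
    refine Ideal.span_le.2 ?_
    rintro _ ⟨i, hi, rfl⟩
    simpa using hi

end VarIdeal

section Koszul

variable {R : Type} [CommRing R]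

theorem KillsCohomology.of_iso {P : ChainComplex (ModuleCat R) ℕ} {N N' : ModuleCat R} (e : N ≅ N')
    {i : ℕ} {a : R} (h : KillsCohomology P N i a) : KillsCohomology P N' i a := by
  intro f hf
  obtain ⟨g, hg⟩ := h (f ≫ e.inv) (by rw [reassoc_of% hf, Limits.zero_comp])
  exact ⟨g ≫ e.hom, by rw [reassoc_of% hg, Linear.smul_comp, Category.assoc, e.inv_hom_id,
    Category.comp_id]⟩

theorem mem_of_killsCohomology_zero {I : Ideal R}
    (P : ProjectiveResolution (ModuleCat.of R (R ⧸ I))) {a : R}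
    (h : KillsCohomology P.complex (ModuleCat.of R (R ⧸ I)) 0 a) : a ∈ I := by
  let p : P.complex.X 0 ⟶ ModuleCat.of R (R ⧸ I) := P.π.f 0
  have hp : Function.Surjective p := (ModuleCat.epi_iff_surjective _).1
    (inferInstanceAs (Epi (P.π.f 0)))
  obtain ⟨g, hg⟩ := h p P.complex_d_comp_π_f_zero
  obtain ⟨y, hy⟩ := hp (Ideal.Quotient.mk I 1)
  have h0 : a • p = 0 := by rw [← hg]; simp
  have h1 : a • p y = 0 := congr($h0 y)
  rw [hy] at h1
  rw [← Ideal.Quotient.eq_zero_iff_mem, ← h1]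
  exact congrArg (Ideal.Quotient.mk I) (mul_one a).symm

theorem eq_zero_of_smul_hom_eq_zero {Q L : ModuleCat R} {x : R} (hx : ∀ y : L, x • y = 0 → y = 0)
    (g : Q ⟶ L) (hg : x • g = 0) : g = 0 := by
  ext q
  exact hx _ congr($hg q)

theorem exists_hom_eq_smul {Q L : ModuleCat R} {x : R} (hx : ∀ y : L, x • y = 0 → y = 0)
    (g : Q ⟶ L) (hg : ∀ q, ∃ y : L, x • y = g q) : ∃ h : Q ⟶ L, g = x • h := by
  have hinj : Function.Injective (LinearMap.lsmul R L x) :=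
    (injective_iff_map_eq_zero _).2 hx
  let e := LinearEquiv.ofInjective (LinearMap.lsmul R L x) hinj
  refine ⟨ModuleCat.ofHom (e.symm.toLinearMap ∘ₗ g.hom.codRestrict _ hg), ?_⟩
  ext q
  exact (congrArg Subtype.val (e.apply_symm_apply ⟨g q, hg q⟩)).symm

end Koszul

section VarIdealExt

variable {σ k : Type} [Field k]

theorem mem_varIdeal_insert [DecidableEq σ] {s : Finset σ} {x : σ} {t : MvPolynomial σ k} :
    t ∈ varIdeal k (insert x s) ↔ ∃ a, ∃ z ∈ varIdeal k s, t = a * X x + z := by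
  rw [varIdeal, Finset.coe_insert, Set.image_insert_eq, Ideal.mem_span_insert]
  rfl

theorem killsCohomology_varIdeal [DecidableEq σ] {c : Finset σ}
    (P : ProjectiveResolution (quotMod k (varIdeal k c))) (m : ℕ) {s : Finset σ} (hs : s ⊆ c)
    (hm : s.card + m = c.card) :
    (∀ j < m, KillsCohomology P.complex (quotMod k (varIdeal k s)) j 1) ∧
      ∀ a, KillsCohomology P.complex (quotMod k (varIdeal k s)) m a → a ∈ varIdeal k c := by
  induction m generalizing s with
  | zero =>
    obtain rfl := Finset.eq_of_subset_of_card_le hs hm.ge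
    exact ⟨fun j hj ↦ absurd hj (Nat.not_lt_zero j), fun a h ↦ mem_of_killsCohomology_zero P h⟩
  | succ m ih =>
    obtain ⟨x, hxc, hxs⟩ := Finset.exists_mem_notMem_of_card_lt_card (s := s) (t := c) (by omega)
    obtain ⟨ih1, ih2⟩ := ih (Finset.insert_subset hxc hs)
      (by rw [Finset.card_insert_of_notMem hxs]; omega)
    have hle : varIdeal k s ≤ varIdeal k (insert x s) :=
      fun z hz ↦ mem_varIdeal_insert.2 ⟨0, z, hz, by simp⟩
    let p : quotMod k (varIdeal k s) ⟶ quotMod k (varIdeal k (insert x s)) :=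
      ModuleCat.ofHom (Submodule.factor hle)
    have : Epi p := (ModuleCat.epi_iff_surjective _).2 (Submodule.factor_surjective hle)
    have hxp : (X x : MvPolynomial σ k) • p = 0 := by
      refine ModuleCat.hom_ext (LinearMap.ext fun y ↦ ?_)
      obtain ⟨y, rfl⟩ := Ideal.Quotient.mk_surjective y
      exact Ideal.Quotient.eq_zero_iff_mem.2
        (Ideal.mul_mem_right y _ (X_mem_varIdeal_iff.2 (Finset.mem_insert_self x s)))
    have hx : ∀ y : quotMod k (varIdeal k s), (X x : MvPolynomial σ k) • y = 0 → y = 0 := by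
      intro y hy
      obtain ⟨y, rfl⟩ := Ideal.Quotient.mk_surjective y
      have : X x * y ∈ varIdeal k s := Ideal.Quotient.eq_zero_iff_mem.1 hy
      exact Ideal.Quotient.eq_zero_iff_mem.2
        (((isPrime_varIdeal s).mem_or_mem this).resolve_left (by rwa [X_mem_varIdeal_iff]))
    have hp : ∀ {Q} (g : Q ⟶ quotMod k (varIdeal k s)), g ≫ p = 0 →
        ∃ h : Q ⟶ quotMod k (varIdeal k s), g = (X x : MvPolynomial σ k) • h := by
      refine fun g hg ↦ exists_hom_eq_smul hx g fun q ↦ ?_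
      have h0 : p (g q) = 0 := congr($hg q)
      obtain ⟨y, hy⟩ := Ideal.Quotient.mk_surjective (g q)
      rw [← hy] at h0 ⊢
      obtain ⟨b, z, hz, rfl⟩ := mem_varIdeal_insert.1 (Ideal.Quotient.eq_zero_iff_mem.1 h0)
      refine ⟨Ideal.Quotient.mk _ b, Ideal.Quotient.eq.2 ?_⟩
      change X x * b - (b * X x + z) ∈ varIdeal k s
      rw [mul_comm, sub_add_cancel_left]
      exact neg_mem hz
    have hann : (X x : MvPolynomial σ k) ∈
        Module.annihilator (MvPolynomial σ k) (quotMod k (varIdeal k c)) :=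
      (Ideal.annihilator_quotient (I := varIdeal k c)).ge (X_mem_varIdeal_iff.2 hxc)
    have h1 : ∀ j < m + 1, KillsCohomology P.complex (quotMod k (varIdeal k s)) j 1 := fun j hj ↦
      (killsCohomology_of_mem_annihilator P hann).vanish_of_quotient p hxp hp
        (eq_zero_of_smul_hom_eq_zero hx) fun j' hj' ↦ ih1 j' (by omega)
    exact ⟨h1, fun a ha ↦ ih2 a ((h1 m (Nat.lt_succ_self m)).of_quotient p hxp hp
      (eq_zero_of_smul_hom_eq_zero hx) ha)⟩

/-- `Ext^c(S/P, S)` is a faithful `S/P`-module for a prime `P` generated by `c` variables. -/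
theorem annihilator_ext_varIdeal_le [DecidableEq σ] (c : Finset σ) :
    Module.annihilator _ (extM (quotMod k (varIdeal k c)) (ModuleCat.of _ (MvPolynomial σ k))
      c.card) ≤ varIdeal k c := by
  intro a ha
  let P := projectiveResolution (quotMod k (varIdeal k c))
  have ha := (mem_annihilator_ext_iff P _ _ _).1 ha
  have hbot : varIdeal k (∅ : Finset σ) = ⊥ := by simp [varIdeal]
  refine (killsCohomology_varIdeal P c.card (Finset.empty_subset c) (by simp)).2 a (ha.of_iso ?_)
  exact (Submodule.quotEquivOfEqBot _ hbot).symm.toModuleIso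

end VarIdealExt

section SymbolicPower

variable {σ k : Type} [Field k]

theorem modDim_ext_le_of_traceData {R T ι : Type} [CommRing R] [CommRing T] [Fintype ι]
    {f : R →+* T} (D : TraceData f ι) (π : T →+ R) (hπ : ∀ r t, π (f r * t) = r * π t)
    (hone : π 1 = 1) {I : Ideal R} {J : Ideal T} (hf : I ≤ J.comap f) (hJ : ∀ t ∈ J, π t ∈ I)
    (i : ℕ) :
    modDim (extM (ModuleCat.of R (R ⧸ I)) (ModuleCat.of R R) i) ≤
      modDim (extM (ModuleCat.of T (T ⧸ J)) (ModuleCat.of T T) i) := by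
  obtain ⟨u, v, huv⟩ := exists_retract π hπ hone hf hJ
  have hle : (Module.annihilator T (extM (ModuleCat.of T (T ⧸ J)) (ModuleCat.of T T) i)).comap f ≤
      Module.annihilator R (extM (ModuleCat.of R (R ⧸ I)) (ModuleCat.of R R) i) := fun r hr ↦
    mul_one r ▸ mul_mem_annihilator_ext u v huv (D.mem_annihilator_ext _ i r hr)
  exact (ringKrullDim_le_of_surjective _ (Ideal.Quotient.factor_surjective hle)).trans
    (ringKrullDim_quotient_comap_le f D.isIntegral _)

theorem mem_symbPow_iff {R : Type} [CommRing R] {I : Ideal R} {a : ℕ} {t : R} :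
    t ∈ symbPow I a ↔ ∀ P ∈ I.minimalPrimes, t ∈ P ^ a := by
  simp only [symbPow, Submodule.mem_sInf, Set.mem_ofPred_eq]
  exact ⟨fun h P hP ↦ h _ ⟨P, hP, rfl⟩, by rintro h _ ⟨P, hP, rfl⟩; exact h P hP⟩

theorem modDim_serreK_symbPow_le [Fintype σ] (K : Set (Finset σ)) {a b q : ℕ} (hq : q ≠ 0)
    (h₁ : b ≤ q * a) (h₂ : q * a < b + q) (j : ℕ) :
    modDim (serreK k (quotMod k (symbPow (srIdeal k K) a)) j) ≤
      modDim (serreK k (quotMod k (symbPow (srIdeal k K) b)) j) := by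
  classical
  refine modDim_ext_le_of_traceData (expandTraceData hq) (expandComp hq 0)
    (expandComp_mul hq fun _ ↦ Nat.pos_of_ne_zero hq) (expandComp_zero_one hq) ?_ ?_ _
  · intro t ht
    refine mem_symbPow_iff.2 fun P hP ↦ ?_
    have := mem_symbPow_iff.1 ht P hP
    obtain ⟨s, rfl⟩ := exists_eq_varIdeal hP
    exact expand_mem_varIdeal_pow h₁ this
  · intro t ht
    refine mem_symbPow_iff.2 fun P hP ↦ ?_
    have := mem_symbPow_iff.1 ht P hP
    obtain ⟨s, rfl⟩ := exists_eq_varIdeal hP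
    exact expandComp_mem_varIdeal_pow hq h₂ this

theorem exists_mul_mem_symbPow_one {R : Type} [CommRing R] [IsNoetherianRing R] {I P : Ideal R}
    (hP : P ∈ I.minimalPrimes) : ∃ w ∉ P, ∀ t ∈ P, w * t ∈ symbPow I 1 := by
  classical
  have hex : ∀ Q ∈ I.minimalPrimes, Q ≠ P → ∃ x ∈ Q, x ∉ P := fun Q hQ hne ↦ by
    by_contra! h
    exact hne (le_antisymm h (hP.2 hQ.1 h))
  choose! x hxQ hxP using hex
  have hfin := Ideal.finite_minimalPrimes_of_isNoetherianRing R I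
  have := hP.1.1
  refine ⟨∏ Q ∈ hfin.toFinset.erase P, x Q, fun h ↦ ?_, fun t ht ↦ mem_symbPow_iff.2 fun Q hQ ↦ ?_⟩
  · obtain ⟨Q, hQ, hxQ⟩ := Ideal.IsPrime.prod_mem_iff.1 h
    rw [Finset.mem_erase, Set.Finite.mem_toFinset] at hQ
    exact hxP Q hQ.2 hQ.1 hxQ
  · rw [pow_one]
    by_cases hQP : Q = P
    · exact hQP.symm ▸ Ideal.mul_mem_left P _ ht
    · refine Ideal.mul_mem_right _ _
        (Ideal.mem_of_dvd _ (Finset.dvd_prod_of_mem x ?_) (hxQ Q hQ hQP))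
      simp [hQP, hQ]

theorem annihilator_ext_symbPow_one_le [Fintype σ] {I : Ideal (MvPolynomial σ k)}
    {s : Finset σ} (hs : varIdeal k s ∈ I.minimalPrimes) :
    Module.annihilator _ (extM (quotMod k (symbPow I 1)) (ModuleCat.of _ (MvPolynomial σ k))
      s.card) ≤ varIdeal k s := by
  classical
  obtain ⟨w, hw, hwI⟩ := exists_mul_mem_symbPow_one hs
  have hle : symbPow I 1 ≤ varIdeal k s := fun t ht ↦ by
    simpa using mem_symbPow_iff.1 ht _ hs
  let u : quotMod k (varIdeal k s) ⟶ quotMod k (symbPow I 1) :=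
    ModuleCat.ofHom (Submodule.mapQ _ _ (LinearMap.lsmul _ _ w) hwI)
  let v : quotMod k (symbPow I 1) ⟶ quotMod k (varIdeal k s) :=
    ModuleCat.ofHom (Submodule.factor hle)
  have huv : u ≫ v = w • 𝟙 _ := by
    refine ModuleCat.hom_ext (LinearMap.ext fun y ↦ ?_)
    obtain ⟨y, rfl⟩ := Ideal.Quotient.mk_surjective y
    rfl
  intro a ha
  exact ((isPrime_varIdeal s).mem_or_mem (annihilator_ext_varIdeal_le s
    (mul_mem_annihilator_ext u v huv ha))).resolve_right hw

theorem srIdeal_ne_top {K : Set (Finset σ)} [Fintype σ] (hK : IsComplex K) : srIdeal k K ≠ ⊤ := by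
  obtain ⟨F, hF⟩ := hK.1
  refine ne_top_of_le_ne_top (isPrime_varIdeal (k := k) Finset.univ).ne_top (Ideal.span_le.2 ?_)
  rintro _ ⟨G, hG, rfl⟩
  obtain ⟨i, hi⟩ : G.Nonempty := by
    rw [Finset.nonempty_iff_ne_empty]
    rintro rfl
    exact hG (hK.2 F hF _ (Finset.empty_subset F))
  exact Ideal.mem_of_dvd _ (Finset.dvd_prod_of_mem _ hi) (X_mem_varIdeal_iff.2 (Finset.mem_univ i))

theorem exists_le_modDim_serreK_symbPow_one [Fintype σ] {K : Set (Finset σ)} (hK : IsComplex K) :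
    ∃ j : ℕ, (j : WithBot ℕ∞) ≤ modDim (serreK k (quotMod k (symbPow (srIdeal k K) 1)) j) := by
  obtain ⟨M, hM, hle⟩ := Ideal.exists_le_maximal _ (srIdeal_ne_top (k := k) hK)
  obtain ⟨P, hP, -⟩ := Ideal.exists_minimalPrimes_le hle
  obtain ⟨s, rfl⟩ := exists_eq_varIdeal hP
  refine ⟨Fintype.card σ - s.card, (le_ringKrullDim_quotient_varIdeal (k := k) s).trans ?_⟩
  rw [modDim, serreK, Nat.card_eq_fintype_card, Nat.sub_sub_self s.card_le_univ]
  exact ringKrullDim_le_of_surjective _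
    (Ideal.Quotient.factor_surjective (annihilator_ext_symbPow_one_le hP))

end SymbolicPower

/-- for a pure simplicial complex `Δ`,
`S_2-depth(S/I_Δ^(2)) ≥ S_2-depth(S/I_Δ^(ℓ))` for all `ℓ ≥ 3`. -/
theorem serreDepth_symbPow_two_ge
    (k : Type) [Field k] (n : ℕ)
    (K : Set (Finset (Fin n))) (hK : IsComplex K) (hpure : Pure K)
    (ℓ : ℕ) (hℓ : 3 ≤ ℓ) :
    serreDepth k 2 (quotMod k (symbPow (srIdeal k K) ℓ)) ≤
      serreDepth k 2 (quotMod k (symbPow (srIdeal k K) 2)) := by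
  obtain ⟨j, hj⟩ := exists_le_modDim_serreK_symbPow_one (k := k) hK
  have hne : { j : ℕ | ((j + 1 - 2 : ℕ) : WithBot ℕ∞) ≤
      modDim (serreK k (quotMod k (symbPow (srIdeal k K) 2)) j) }.Nonempty :=
    ⟨j, le_trans (mod_cast (by omega : j + 1 - 2 ≤ j))
      (hj.trans (modDim_serreK_symbPow_le K two_ne_zero le_rfl (by norm_num) j))⟩
  exact Nat.sInf_le ((Nat.sInf_mem hne).trans
    (modDim_serreK_symbPow_le K (q := ℓ - 1) (by omega) (by omega) (by omega) _))

end SerrePaper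
end

section
/- Let Δ be a simplicial complex on [n] with dim Δ ≥ 1 and let ℓ ≥ 2. Then H^1_m(S/I_Δ^(ℓ)) = 0 if and only if the following holds: for any facets F_0, G_0 of Δ with F_0 ∩ G_0 = ∅ and any a = (a_1,…,a_n) ∈ ℕ^n with Σ_{i∈[n]} a_i ≥ ℓ, Σ_{i∉F_0} a_i = ℓ − 1, and Σ_{i∉G_0} a_i = ℓ − 1, there exist facets F, G of Δ_a(I_Δ^(ℓ)) such that F ∩ F_0 ≠ ∅, G ∩ G_0 ≠ ∅, and F ∩ G ≠ ∅. -/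
/-!
Common definitions for formalizing "The Serre depth of Stanley–Reisner rings and
the depth of their symbolic powers" (Muta–Terai).
-/

open CategoryTheory MvPolynomial

namespace SerrePaper

/-- The degree complex `Δ_a(I_Δ^(ℓ))` appearing in Takayama's formula; by a result of
Minh and Trung it is generated by the facets `F` of `Δ` with `∑_{i ∉ F} a_i ≤ ℓ - 1`. -/
def degreeComplex {n : ℕ} (K : Set (Finset (Fin n))) (a : Fin n → ℕ) (ℓ : ℕ) :
    Set (Finset (Fin n)) :=
  { G | ∃ F : Finset (Fin n), IsFacet K F ∧ G ⊆ F ∧ ∑ i ∈ Fᶜ, a i ≤ ℓ - 1 }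

section

open Limits Opposite

universe u

section
variable {D : Type*} [Category* D] [Abelian D]

/-- The morphism out of the first homology induced by a `1`-cocycle `κ`. -/
noncomputable def homologyClass (C : ChainComplex D ℕ) {A : D} (κ : C.X 1 ⟶ A)
    (hκ : C.d 2 1 ≫ κ = 0) : C.homology 1 ⟶ A :=
  C.homologyι 1 ≫ C.descOpcycles κ 2 (by simp) hκ

theorem homologyMap_comp_homologyClass {C C' : ChainComplex D ℕ} (g : C' ⟶ C) {A : D}
    (κ : C.X 1 ⟶ A) (hκ : C.d 2 1 ≫ κ = 0) :
    HomologicalComplex.homologyMap g 1 ≫ homologyClass C κ hκ =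
      homologyClass C' (g.f 1 ≫ κ) (by rw [← g.comm_assoc, hκ, comp_zero]) := by
  rw [homologyClass, homologyClass, HomologicalComplex.homologyι_naturality_assoc]
  congr 1
  rw [← cancel_epi (C'.pOpcycles 1)]
  simp

theorem exists_factor_of_homologyClass_eq_zero (C : ChainComplex D ℕ) {A : D} [Injective A]
    (κ : C.X 1 ⟶ A) (hκ : C.d 2 1 ≫ κ = 0) (h : homologyClass C κ hκ = 0) :
    ∃ l : C.X 0 ⟶ A, C.d 1 0 ≫ l = κ := by
  have hex : (ShortComplex.mk (C.homologyι 1) (C.fromOpcycles 1 0) (by simp)).Exact := by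
    apply ShortComplex.exact_of_f_is_kernel
    exact C.homologyIsKernel 1 0 (by simp)
  refine ⟨hex.descToInjective (C.descOpcycles κ 2 (by simp) hκ) h, ?_⟩
  have := hex.comp_descToInjective (C.descOpcycles κ 2 (by simp) hκ) h
  dsimp at this
  rw [← C.p_fromOpcycles, Category.assoc, this]
  simp

end

theorem exists_ext_one_element {R : Type u} [CommRing R] {X M : ModuleCat.{u} R}
    (P : ProjectiveResolution X) (α : P.complex.X 1 ⟶ M) (hα : P.complex.d 2 1 ≫ α = 0) :
    ∃ e : ((Ext R (ModuleCat.{u} R) 1).obj (op X)).obj M,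
      ∀ (Y : ModuleCat.{u} R) (f : Y ⟶ X) (Q : ProjectiveResolution Y),
        (((Ext R (ModuleCat.{u} R) 1).map f.op).app M).hom e = 0 →
          ∃ β : Q.complex.X 0 ⟶ M,
            Q.complex.d 1 0 ≫ β = (ProjectiveResolution.lift f Q P).f 1 ≫ α := by
  let F := ((linearYoneda R (ModuleCat.{u} R)).obj M).rightOp
  let A : (ModuleCat.{u} R)ᵒᵖ := op (ModuleCat.of R R)
  let κ : ((F.mapHomologicalComplex _).obj P.complex).X 1 ⟶ A :=
    Quiver.Hom.op (ModuleCat.ofHom (LinearMap.toSpanSingleton R (P.complex.X 1 ⟶ M) α))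
  have hκ : ((F.mapHomologicalComplex _).obj P.complex).d 2 1 ≫ κ = 0 := by
    apply Quiver.Hom.unop_inj
    ext
    change P.complex.d 2 1 ≫ ((1 : R) • α) = 0
    simp [hα]
  let x : (F.leftDerived 1).obj X ⟶ A := (P.isoLeftDerivedObj F 1).hom ≫ homologyClass _ κ hκ
  refine ⟨x.unop.hom (1 : R), fun Y f Q h => ?_⟩
  have h1 : (F.leftDerived 1).map f ≫ x = 0 := by
    apply Quiver.Hom.unop_inj
    ext
    exact h
  have h2 : HomologicalComplex.homologyMap ((F.mapHomologicalComplex _).map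
      (ProjectiveResolution.lift f Q P)) 1 ≫ homologyClass _ κ hκ = 0 :=
    (cancel_epi (Q.isoLeftDerivedObj F 1).hom).1
      (((ProjectiveResolution.isoLeftDerivedObj_hom_naturality_assoc f Q P _
        (ProjectiveResolution.lift_commutes_zero f Q P) F 1 (homologyClass _ κ hκ)).symm.trans
        h1).trans comp_zero.symm)
  rw [homologyMap_comp_homologyClass] at h2
  obtain ⟨l, hl⟩ := exists_factor_of_homologyClass_eq_zero _ _ _ h2
  refine ⟨l.unop.hom (1 : R), ?_⟩
  have h3 := congrArg (fun z => z.unop.hom (1 : R)) hl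
  refine h3.trans ?_
  change (ProjectiveResolution.lift f Q P).f 1 ≫ ((1 : R) • α) = _
  simp

section
variable {R : Type u} [CommRing R]

theorem resolution_augmentation {J : Ideal R}
    (P : ProjectiveResolution (ModuleCat.of R (R ⧸ J))) :
    ∃ (ε : P.complex.X 0 →ₗ[R] R ⧸ J) (h : P.complex.X 0 →ₗ[R] R) (p₀ : P.complex.X 0),
      (P.π.f 0).hom = ε ∧ (∀ p, ε p = Ideal.Quotient.mk J (h p)) ∧ ε p₀ = 1 ∧
      (∀ p, ε p = 0 ↔ ∃ q, (P.complex.d 1 0).hom q = p) := by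
  let ε : P.complex.X 0 →ₗ[R] R ⧸ J := (P.π.f 0).hom
  have hε : Function.Surjective ε :=
    (ModuleCat.epi_iff_surjective (P.π.f 0)).1 inferInstance
  have hproj : Module.Projective R (P.complex.X 0) :=
    (IsProjective.iff_projective (R := R) (P.complex.X 0)).2 (P.projective 0)
  obtain ⟨h, hh⟩ := Module.projective_lifting_property J.mkQ ε (Submodule.mkQ_surjective J)
  obtain ⟨p₀, hp₀⟩ := hε 1
  refine ⟨ε, h, p₀, rfl, fun p => (LinearMap.congr_fun hh p).symm, hp₀, fun p => ⟨fun hp => ?_, ?_⟩⟩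
  · exact (ShortComplex.moduleCat_exact_iff _).1 P.exact₀ p hp
  · rintro ⟨q, rfl⟩
    exact LinearMap.congr_fun (congrArg ModuleCat.Hom.hom P.complex_d_comp_π_f_zero) q

theorem isZero_ext_one_of_extends (J : Ideal R) (M : ModuleCat.{u} R)
    (hJ : ∀ φ : J →ₗ[R] M, ∃ f : M, ∀ y : J, φ y = (y : R) • f) :
    IsZero (((Ext R (ModuleCat.{u} R) 1).obj (op (ModuleCat.of R (R ⧸ J)))).obj M) := by
  let P := projectiveResolution (ModuleCat.of R (R ⧸ J))
  refine IsZero.of_iso ?_ (P.isoExt 1 M)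
  rw [← HomologicalComplex.exactAt_iff_isZero_homology,
    HomologicalComplex.exactAt_iff' _ 0 1 2 (by simp) (by simp), ShortComplex.moduleCat_exact_iff]
  intro α hα
  change P.complex.X 1 ⟶ M at α
  change P.complex.d 2 1 ≫ α = 0 at hα
  change ∃ β : P.complex.X 0 ⟶ M, P.complex.d 1 0 ≫ β = α
  obtain ⟨ε, h, p₀, -, hh, hp₀, hker⟩ := resolution_augmentation P
  have hα' : ∀ q : P.complex.X 1, (P.complex.d 1 0).hom q = 0 → α.hom q = 0 := by
    intro q hq
    obtain ⟨r, rfl⟩ := (ShortComplex.moduleCat_exact_iff _).1 (P.exact_succ 0) q hq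
    exact LinearMap.congr_fun (congrArg ModuleCat.Hom.hom hα) r
  let d : P.complex.X 1 →ₗ[R] P.complex.X 0 := (P.complex.d 1 0).hom
  have hlift : ∀ p : LinearMap.ker ε, ∃ q, d q = p := fun p => (hker p).1 p.2
  choose s hs using hlift
  have hs' : ∀ (p : LinearMap.ker ε) (q), d q = p → α.hom (s p) = α.hom q := fun p q hq => by
    rw [← sub_eq_zero, ← map_sub]
    refine hα' _ ?_
    change d _ = 0
    rw [map_sub, hs, hq, sub_self]
  let α' : LinearMap.ker ε →ₗ[R] M :=
    { toFun p := α.hom (s p)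
      map_add' p q := by
        rw [hs' (p + q) (s p + s q) (by rw [map_add, hs, hs]; rfl), map_add]
      map_smul' r p := by
        rw [hs' (r • p) (r • s p) (by rw [map_smul, hs]; rfl), map_smul]; rfl }
  have hεp : ∀ y : R, ε (y • p₀) = Ideal.Quotient.mk J y := fun y => by
    rw [map_smul, hp₀, Algebra.smul_def, mul_one]; rfl
  let ι : J →ₗ[R] LinearMap.ker ε :=
    { toFun y := ⟨(y : R) • p₀, by
        rw [LinearMap.mem_ker, hεp]; exact Ideal.Quotient.eq_zero_iff_mem.2 y.2⟩
      map_add' y z := Subtype.ext (add_smul _ _ _)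
      map_smul' r y := Subtype.ext (mul_smul _ _ _) }
  obtain ⟨f, hf⟩ := hJ (α' ∘ₗ ι)
  let ρ : P.complex.X 0 →ₗ[R] LinearMap.ker ε :=
    LinearMap.codRestrict _ (LinearMap.id - (LinearMap.toSpanSingleton R _ p₀) ∘ₗ h) (fun p => by
      change ε (p - h p • p₀) = 0
      rw [map_sub, hεp, hh, sub_self])
  refine ⟨ModuleCat.ofHom (α' ∘ₗ ρ + (LinearMap.toSpanSingleton R M f) ∘ₗ h), ?_⟩
  ext q
  change α' (ρ (d q)) + h (d q) • f = α.hom q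
  have hdq : ε (d q) = 0 := (hker _).2 ⟨q, rfl⟩
  have hJq : h (d q) ∈ J := Ideal.Quotient.eq_zero_iff_mem.1 ((hh _).symm.trans hdq)
  have := hf ⟨h (d q), hJq⟩
  rw [← this, LinearMap.comp_apply, ← map_add]
  refine hs' _ _ ?_
  change d q = (d q - h (d q) • p₀) + h (d q) • p₀
  abel

theorem exists_ext_one_element_of_not_extends {J : Ideal R} (M : ModuleCat.{u} R)
    (φ : J →ₗ[R] M) :
    ∃ e : ((Ext R (ModuleCat.{u} R) 1).obj (op (ModuleCat.of R (R ⧸ J)))).obj M,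
      ∀ (J' : Ideal R) (hJ : J' ≤ J),
        (((Ext R (ModuleCat.{u} R) 1).map (Quiver.Hom.op (ModuleCat.ofHom
          (Submodule.mapQ J' J LinearMap.id hJ)))).app M).hom e = 0 →
          ∃ f : M, ∀ y (hy : y ∈ J'), φ ⟨y, hJ hy⟩ = y • f := by
  let P := projectiveResolution (ModuleCat.of R (R ⧸ J))
  obtain ⟨ε, h, p₀, hε, hh, hp₀, hker⟩ := resolution_augmentation P
  let hd : P.complex.X 1 →ₗ[R] J := LinearMap.codRestrict J (h ∘ₗ (P.complex.d 1 0).hom)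
    (fun q => Ideal.Quotient.eq_zero_iff_mem.1 ((hh _).symm.trans ((hker _).2 ⟨q, rfl⟩)))
  obtain ⟨e, he⟩ := exists_ext_one_element P (ModuleCat.ofHom (φ ∘ₗ hd)) (by
    ext q
    change φ (hd ((P.complex.d 2 1).hom q)) = 0
    convert map_zero φ
    refine Subtype.ext ?_
    change h (((P.complex.d 2 1) ≫ (P.complex.d 1 0)).hom q) = 0
    simp)
  refine ⟨e, fun J' hJ h0 => ?_⟩
  let Q := projectiveResolution (ModuleCat.of R (R ⧸ J'))
  obtain ⟨ε', h', q₀, hε', hh', hq₀, hker'⟩ := resolution_augmentation Q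
  obtain ⟨β, hβ⟩ := he _ _ Q h0
  let g := ProjectiveResolution.lift (ModuleCat.ofHom (Submodule.mapQ J' J LinearMap.id hJ)) Q P
  have hg : ε ((g.f 0).hom q₀) = 1 := by
    have h1 := LinearMap.congr_fun (congrArg ModuleCat.Hom.hom
      (ProjectiveResolution.lift_commutes_zero
        (ModuleCat.ofHom (Submodule.mapQ J' J LinearMap.id hJ)) Q P)) q₀
    rw [← hε]
    refine h1.trans ?_
    exact (congrArg (Submodule.mapQ J' J LinearMap.id hJ)
      ((LinearMap.congr_fun hε' q₀).trans hq₀)).trans rfl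
  have hj : h ((g.f 0).hom q₀) - 1 ∈ J := by
    rw [← Ideal.Quotient.eq_zero_iff_mem, map_sub, ← hh, hg, map_one, sub_self]
  refine ⟨β.hom q₀ - φ ⟨_, hj⟩, fun y hy => ?_⟩
  have hy0 : ε' (y • q₀) = 0 := by
    rw [map_smul, hq₀, Algebra.smul_def, mul_one]
    exact Ideal.Quotient.eq_zero_iff_mem.2 hy
  obtain ⟨q, hq⟩ := (hker' _).1 hy0
  have h2 : β.hom ((Q.complex.d 1 0).hom q) = φ (hd ((g.f 1).hom q)) :=
    LinearMap.congr_fun (congrArg ModuleCat.Hom.hom hβ) q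
  have h3 : (P.complex.d 1 0).hom ((g.f 1).hom q) = (g.f 0).hom ((Q.complex.d 1 0).hom q) :=
    LinearMap.congr_fun (congrArg ModuleCat.Hom.hom (g.comm 1 0)) q
  rw [hq, map_smul] at h2
  rw [smul_sub, h2, ← map_smul, ← map_sub]
  congr 1
  refine Subtype.ext ?_
  change y = h ((P.complex.d 1 0).hom ((g.f 1).hom q)) - y * (h ((g.f 0).hom q₀) - 1)
  rw [h3, hq, map_smul, map_smul, smul_eq_mul]
  ring

end

section
variable {R : Type} [CommRing R]

theorem subsingleton_localCohomology_one (J : Ideal R) (M : ModuleCat.{0} R)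
    (hJ : ∀ (t : ℕ) (φ : (J ^ t : Ideal R) →ₗ[R] M), ∃ f : M, ∀ y : (J ^ t : Ideal R),
      φ y = (y : R) • f) :
    Subsingleton ((localCohomology J 1).obj M) := by
  let D := localCohomology.diagram (localCohomology.idealPowersDiagram J) 1
  have hD : ∀ t, Subsingleton ((D ⋙ (evaluation _ _).obj M).obj t) := fun t =>
    ModuleCat.subsingleton_of_isZero (isZero_ext_one_of_extends _ M (hJ (unop (unop t))))
  let i := colimitObjIsoColimitCompEvaluation D M
  have : Subsingleton (colimit (D ⋙ (evaluation _ _).obj M) : ModuleCat R) := by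
    refine ⟨fun x y => ?_⟩
    obtain ⟨t, x, rfl⟩ := Concrete.colimit_exists_rep _ x
    obtain ⟨u, y, rfl⟩ := Concrete.colimit_exists_rep _ y
    rw [Subsingleton.elim x 0, Subsingleton.elim y 0, map_zero, map_zero]
  exact i.toLinearEquiv.toEquiv.subsingleton

theorem nontrivial_localCohomology_one (J : Ideal R) (M : ModuleCat.{0} R) (t : ℕ)
    (φ : (J ^ t : Ideal R) →ₗ[R] M)
    (hφ : ∀ (u : ℕ) (hu : t ≤ u), ¬ ∃ f : M, ∀ y (hy : y ∈ J ^ u),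
      φ ⟨y, Ideal.pow_le_pow_right hu hy⟩ = y • f) :
    Nontrivial ((localCohomology J 1).obj M) := by
  let D := localCohomology.diagram (localCohomology.idealPowersDiagram J) 1
  let i := colimitObjIsoColimitCompEvaluation D M
  obtain ⟨e, he⟩ := exists_ext_one_element_of_not_extends M φ
  let T : ℕᵒᵖᵒᵖ := op (op t)
  change ((D ⋙ (evaluation _ _).obj M).obj T) at e
  have : Nontrivial (colimit (D ⋙ (evaluation _ _).obj M) : ModuleCat R) := by
    refine ⟨⟨(colimit.ι (D ⋙ (evaluation _ _).obj M) T).hom e, 0, fun h0 => ?_⟩⟩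
    obtain ⟨u, g, hg⟩ := Concrete.colimit_rep_eq_zero R (D ⋙ (evaluation _ _).obj M) _ _ h0
    exact hφ (unop (unop u)) (leOfHom g.unop.unop) (he _ _ hg)
  exact i.toLinearEquiv.toEquiv.nontrivial

end

end

section
variable {k : Type} [Field k]

theorem mem_span_X_image_pow_iff {n : ℕ} (s : Finset (Fin n)) (ℓ : ℕ)
    (p : MvPolynomial (Fin n) k) :
    p ∈ Ideal.span (X '' (s : Set (Fin n))) ^ ℓ ↔
      ∀ w, coeff w p ≠ 0 → ℓ ≤ ∑ i ∈ s, w i := by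
  constructor
  · induction ℓ generalizing p with
    | zero => simp
    | succ ℓ ih =>
      intro hp
      rw [pow_succ] at hp
      refine Submodule.mul_induction_on hp (fun a ha b hb w hw => ?_) (fun a b ha hb w hw => ?_)
      · rw [coeff_mul] at hw
        obtain ⟨⟨u, v⟩, huv, hne⟩ := Finset.exists_ne_zero_of_sum_ne_zero hw
        have huv := Finset.HasAntidiagonal.mem_antidiagonal.1 huv
        have h1 := ih a ha u (left_ne_zero_of_mul hne)
        obtain ⟨i, hi, hvi⟩ := mem_ideal_span_X_image.1 hb v
          (mem_support_iff.2 (right_ne_zero_of_mul hne))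
        have h2 : v i ≤ ∑ i ∈ s, v i := Finset.single_le_sum (fun _ _ => Nat.zero_le _) hi
        simp only [← huv, Finsupp.add_apply, Finset.sum_add_distrib]
        omega
      · rw [coeff_add] at hw
        by_cases h : coeff w a = 0
        · exact hb w (by rwa [h, zero_add] at hw)
        · exact ha w h
  · intro h
    rw [p.as_sum]
    refine Ideal.sum_mem _ fun w hw => ?_
    rw [monomial_eq, Finsupp.prod_fintype _ _ (fun _ => pow_zero _),
      ← Finset.prod_mul_prod_compl s]
    refine Ideal.mul_mem_left _ _ (Ideal.mul_mem_right _ _ ?_)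
    refine Ideal.pow_le_pow_right (h w (mem_support_iff.1 hw)) ?_
    rw [← Finset.prod_pow_eq_pow_sum]
    exact Ideal.prod_mem_prod fun i hi =>
      Ideal.pow_mem_pow (Ideal.subset_span (Set.mem_image_of_mem _ hi)) _

theorem isPrime_span_X_image {σ : Type*} (s : Set σ) :
    (Ideal.span (X '' s) : Ideal (MvPolynomial σ k)).IsPrime := by
  classical
  let e : MvPolynomial σ k →ₐ[k] MvPolynomial σ k := aeval fun i => if i ∈ s then 0 else X i
  have he : ∀ p, p - e p ∈ (Ideal.span (X '' s) : Ideal (MvPolynomial σ k)) := by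
    intro p
    induction p using MvPolynomial.induction_on with
    | C a => simp [e]
    | add p q hp hq =>
      rw [map_add, add_sub_add_comm]
      exact Ideal.add_mem _ hp hq
    | mul_X p i hp =>
      have hX : X i - e (X i) ∈ (Ideal.span (X '' s) : Ideal (MvPolynomial σ k)) := by
        by_cases hi : i ∈ s
        · simpa [e, hi] using Ideal.subset_span (Set.mem_image_of_mem X hi)
        · simp [e, hi]
      have : p * X i - e (p * X i) = (p - e p) * X i + e p * (X i - e (X i)) := by
        rw [map_mul]; ring
      rw [this]
      exact Ideal.add_mem _ (Ideal.mul_mem_right _ _ hp) (Ideal.mul_mem_left _ _ hX)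
  have hker : (Ideal.span (X '' s) : Ideal (MvPolynomial σ k)) = RingHom.ker e := by
    refine le_antisymm (Ideal.span_le.2 ?_) fun p hp => ?_
    · rintro _ ⟨i, hi, rfl⟩
      simp [e, hi]
    · simpa [(RingHom.mem_ker).1 hp] using he p
  rw [hker]
  exact RingHom.ker_isPrime _

theorem exists_facet_of_mem {V : Type} [Fintype V] {K : Set (Finset V)} {F : Finset V}
    (hF : F ∈ K) : ∃ G, IsFacet K G ∧ F ⊆ G := by
  obtain ⟨G, hFG, hG⟩ := (Set.toFinite K).exists_le_maximal hF
  exact ⟨G, ⟨hG.prop, fun H hH h => (hG.eq_of_le hH h).symm⟩, hFG⟩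

theorem mem_minimalPrimes_srIdeal_iff {n : ℕ} {K : Set (Finset (Fin n))} (hK : IsComplex K)
    (P : Ideal (MvPolynomial (Fin n) k)) :
    P ∈ (srIdeal k K).minimalPrimes ↔
      ∃ F, IsFacet K F ∧ P = Ideal.span (X '' ((Fᶜ : Finset (Fin n)) : Set (Fin n))) := by
  have hle : ∀ F ∈ K, srIdeal k K ≤ Ideal.span (X '' ((Fᶜ : Finset (Fin n)) : Set (Fin n))) := by
    intro F hF
    refine Ideal.span_le.2 ?_
    rintro _ ⟨G, hG, rfl⟩
    obtain ⟨i, hi, hiF⟩ := Finset.not_subset.1 fun h => hG (hK.2 F hF G h)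
    exact Ideal.mem_of_dvd _ (Finset.dvd_prod_of_mem _ hi)
      (Ideal.subset_span (Set.mem_image_of_mem _ (by simpa using hiF)))
  have hge : ∀ Q : Ideal (MvPolynomial (Fin n) k), Q.IsPrime → srIdeal k K ≤ Q →
      ∃ F, IsFacet K F ∧ Ideal.span (X '' ((Fᶜ : Finset (Fin n)) : Set (Fin n))) ≤ Q := by
    classical
    intro Q hQ hKQ
    let G : Finset (Fin n) := Finset.univ.filter fun i => (X i : MvPolynomial (Fin n) k) ∉ Q
    have hG : G ∈ K := by
      by_contra hG
      obtain ⟨i, hi, hiQ⟩ := (Ideal.IsPrime.prod_mem_iff (hp := hQ)).1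
        (hKQ (Ideal.subset_span ⟨G, hG, rfl⟩))
      exact (Finset.mem_filter.1 hi).2 hiQ
    obtain ⟨F, hF, hGF⟩ := exists_facet_of_mem hG
    refine ⟨F, hF, Ideal.span_le.2 ?_⟩
    rintro _ ⟨i, hi, rfl⟩
    by_contra hiQ
    exact (by simpa using hi : i ∉ F) (hGF (by simpa [G] using hiQ))
  constructor
  · intro hP
    obtain ⟨F, hF, hFP⟩ := hge P hP.1.1 hP.1.2
    exact ⟨F, hF, le_antisymm (hP.2 ⟨isPrime_span_X_image _, hle F hF.1⟩ hFP) hFP⟩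
  · rintro ⟨F, hF, rfl⟩
    refine ⟨⟨isPrime_span_X_image _, hle F hF.1⟩, fun Q hQ hQF => ?_⟩
    obtain ⟨G, hG, hGQ⟩ := hge Q hQ.1 hQ.2
    have hFG : F ⊆ G := by
      intro i hi
      by_contra hiG
      obtain ⟨j, hj, hne⟩ := mem_ideal_span_X_image.1
        (hGQ.trans hQF (Ideal.subset_span (Set.mem_image_of_mem X
          (by simpa using hiG : i ∈ ((Gᶜ : Finset (Fin n)) : Set (Fin n))))))
        (Finsupp.single i 1) (by simp [X])
      have hij : i ≠ j := fun h => (by simpa using hj : j ∉ F) (h ▸ hi)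
      exact hne (Finsupp.single_eq_of_ne hij.symm)
    rwa [hF.2 G hG.1 hFG] at hGQ

theorem mem_symbPow_srIdeal_iff {n : ℕ} {K : Set (Finset (Fin n))} (hK : IsComplex K) (ℓ : ℕ)
    (p : MvPolynomial (Fin n) k) :
    p ∈ symbPow (srIdeal k K) ℓ ↔
      ∀ F, IsFacet K F → ∀ w, coeff w p ≠ 0 → ℓ ≤ ∑ i ∈ Fᶜ, w i := by
  rw [symbPow, Submodule.mem_sInf]
  simp only [Set.mem_ofPred_eq, mem_minimalPrimes_srIdeal_iff hK]
  constructor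
  · intro h F hF
    exact (mem_span_X_image_pow_iff _ _ _).1 (h _ ⟨_, ⟨F, hF, rfl⟩, rfl⟩)
  · rintro h _ ⟨_, ⟨F, hF, rfl⟩, rfl⟩
    exact (mem_span_X_image_pow_iff _ _ _).2 (h F hF)

end

section
variable {k : Type} [Field k] {n : ℕ}

variable (k) in
/-- The intersection of the `ℓ`-th powers of the monomial primes generated by the variables
outside the members of `𝓕`. -/
noncomputable def facetIdeal (𝓕 : Set (Finset (Fin n))) (ℓ : ℕ) : Ideal (MvPolynomial (Fin n) k) :=
  ⨅ F ∈ 𝓕, Ideal.span (X '' ((Fᶜ : Finset (Fin n)) : Set (Fin n))) ^ ℓ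

theorem mem_facetIdeal_iff {𝓕 : Set (Finset (Fin n))} {ℓ : ℕ} {p : MvPolynomial (Fin n) k} :
    p ∈ facetIdeal k 𝓕 ℓ ↔ ∀ F ∈ 𝓕, ∀ w, coeff w p ≠ 0 → ℓ ≤ ∑ i ∈ Fᶜ, w i := by
  simp only [facetIdeal, Submodule.mem_iInf, mem_span_X_image_pow_iff]

theorem monomial_mem_facetIdeal {𝓕 : Set (Finset (Fin n))} {ℓ : ℕ} {w : Fin n →₀ ℕ} (c : k)
    (h : ∀ F ∈ 𝓕, ℓ ≤ ∑ i ∈ Fᶜ, w i) : monomial w c ∈ facetIdeal k 𝓕 ℓ := by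
  classical
  refine mem_facetIdeal_iff.2 fun F hF v hv => ?_
  rw [coeff_monomial] at hv
  obtain rfl : w = v := by
    by_contra hne
    exact hv (if_neg hne)
  exact h F hF

theorem symbPow_srIdeal_eq {K : Set (Finset (Fin n))} (hK : IsComplex K) (ℓ : ℕ) :
    symbPow (srIdeal k K) ℓ = facetIdeal k {F | IsFacet K F} ℓ := by
  ext p
  rw [mem_symbPow_srIdeal_iff hK, mem_facetIdeal_iff]
  rfl

theorem exists_linearMap_quotient_inf {R : Type*} [CommRing R] (A B N : Ideal R) (s : R)
    (h : ∀ y ∈ N, s * y ∈ A ⊔ B) :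
    ∃ φ : N →ₗ[R] (R ⧸ A ⊓ B), ∀ y : N, ∃ b ∈ B, s * (y : R) - b ∈ A ∧
      φ y = Ideal.Quotient.mk (A ⊓ B) b := by
  have h' : ∀ y : N, ∃ b ∈ B, s * (y : R) - b ∈ A := fun y => by
    obtain ⟨a, ha, b, hb, hab⟩ := Submodule.mem_sup.1 (h y y.2)
    exact ⟨b, hb, by rwa [← hab, add_sub_cancel_right]⟩
  choose β hβ hβA using h'
  refine ⟨⟨⟨fun y => Ideal.Quotient.mk (A ⊓ B) (β y), fun x y => ?_⟩, fun r x => ?_⟩,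
    fun y => ⟨β y, hβ y, hβA y, rfl⟩⟩
  · rw [← map_add, Ideal.Quotient.eq]
    refine Ideal.mem_inf.2 ⟨?_, B.sub_mem (hβ _) (B.add_mem (hβ x) (hβ y))⟩
    have := A.sub_mem (A.add_mem (hβA x) (hβA y)) (hβA (x + y))
    convert this using 1
    push_cast
    ring
  · rw [RingHom.id_apply, Algebra.smul_def, Ideal.Quotient.algebraMap_eq, ← map_mul,
      Ideal.Quotient.eq]
    refine Ideal.mem_inf.2 ⟨?_, B.sub_mem (hβ _) (B.mul_mem_left r (hβ x))⟩
    have := A.sub_mem (A.mul_mem_left r (hβA x)) (hβA (r • x))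
    convert this using 1
    simp only [smul_eq_mul, Submodule.coe_smul]
    ring

theorem coeff_eq_zero_of_X_pow_mul_mem {𝓕 : Set (Finset (Fin n))} {ℓ u : ℕ} {F : Finset (Fin n)}
    {i : Fin n} (hF : F ∈ 𝓕) (hi : i ∈ F) {a : Fin n →₀ ℕ} (ha : ∑ j ∈ Fᶜ, a j < ℓ)
    {p : MvPolynomial (Fin n) k} (hp : X i ^ u * p ∈ facetIdeal k 𝓕 ℓ) : coeff a p = 0 := by
  by_contra hne
  have h := mem_facetIdeal_iff.1 hp F hF (Finsupp.single i u + a)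
    (by rwa [X_pow_eq_monomial, coeff_monomial_mul, one_mul])
  have h0 : ∑ j ∈ Fᶜ, (Finsupp.single i u + a) j = ∑ j ∈ Fᶜ, a j := by
    refine Finset.sum_congr rfl fun j hj => ?_
    have hij : j ≠ i := by
      rintro rfl
      exact Finset.mem_compl.1 hj hi
    simp [Finsupp.single_eq_of_ne hij]
  omega

theorem monomial_mul_mem_sup_facetIdeal {𝒜 ℬ : Set (Finset (Fin n))} {ℓ : ℕ} (hn : 0 < n)
    {a : Fin n →₀ ℕ}
    (h : ∀ F ∈ 𝒜, ∀ G ∈ ℬ, ∑ i ∈ Fᶜ, a i < ℓ → ∑ i ∈ Gᶜ, a i < ℓ → Disjoint F G)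
    {y : MvPolynomial (Fin n) k} (hy : y ∈ maxIdeal k (Fin n) ^ (n * ℓ)) :
    monomial a 1 * y ∈ facetIdeal k 𝒜 ℓ ⊔ facetIdeal k ℬ ℓ := by
  have hy' : y ∈ Ideal.span ((monomial · (1 : k)) '' (Finsupp.degree ⁻¹' {n * ℓ})) := by
    rw [← pow_idealOfVars_eq_span]
    exact hy
  refine Submodule.span_induction (fun y hy => ?_) (by simp) (fun x y _ _ hx hy => ?_)
    (fun c x _ hx => ?_) hy'
  · obtain ⟨b, hb, rfl⟩ := hy
    obtain ⟨j, hj⟩ : ∃ j, ℓ ≤ b j := by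
      by_contra! hlt
      have : ∑ i, b i < ∑ _i : Fin n, ℓ :=
        Finset.sum_lt_sum_of_nonempty ⟨⟨0, hn⟩, Finset.mem_univ _⟩ fun i _ => hlt i
      rw [← Finsupp.degree_eq_sum, show b.degree = n * ℓ from hb] at this
      simp at this
    have key : ∀ F : Finset (Fin n), (∑ i ∈ Fᶜ, a i < ℓ → j ∉ F) →
        ℓ ≤ ∑ i ∈ Fᶜ, (a + b) i := by
      intro F hF
      simp only [Finsupp.add_apply, Finset.sum_add_distrib]
      by_cases hlt : ∑ i ∈ Fᶜ, a i < ℓ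
      · have := Finset.single_le_sum (fun i _ => Nat.zero_le (b i))
          (Finset.mem_compl.2 (hF hlt))
        omega
      · omega
    rw [monomial_mul, one_mul]
    by_cases hA : ∃ F ∈ 𝒜, ∑ i ∈ Fᶜ, a i < ℓ ∧ j ∈ F
    · obtain ⟨F, hF, hlt, hjF⟩ := hA
      exact Ideal.mem_sup_right (monomial_mem_facetIdeal _ fun G hG => key G fun hGlt hjG =>
        Finset.disjoint_left.1 (h F hF G hG hlt hGlt) hjF hjG)
    · exact Ideal.mem_sup_left (monomial_mem_facetIdeal _ fun F hF => key F fun hlt hjF =>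
        hA ⟨F, hF, hlt, hjF⟩)
  · rw [mul_add]
    exact Ideal.add_mem _ hx hy
  · rw [smul_eq_mul, mul_left_comm]
    exact Ideal.mul_mem_left _ _ hx

theorem H1NE_facetIdeal_union {𝒜 ℬ : Set (Finset (Fin n))} {ℓ : ℕ} {F₀ G₀ : Finset (Fin n)}
    (hF₀ : F₀ ∈ 𝒜) (hG₀ : G₀ ∈ ℬ) (hF₀' : F₀.Nonempty) (hG₀' : G₀.Nonempty) (a : Fin n →₀ ℕ)
    (haF₀ : ∑ i ∈ F₀ᶜ, a i < ℓ) (haG₀ : ∑ i ∈ G₀ᶜ, a i < ℓ)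
    (h : ∀ F ∈ 𝒜, ∀ G ∈ ℬ, ∑ i ∈ Fᶜ, a i < ℓ → ∑ i ∈ Gᶜ, a i < ℓ → Disjoint F G) :
    H1NE k (facetIdeal k (𝒜 ∪ ℬ) ℓ) := by
  obtain ⟨i, hi⟩ := hF₀'
  obtain ⟨j, hj⟩ := hG₀'
  rw [show facetIdeal k (𝒜 ∪ ℬ) ℓ = facetIdeal k 𝒜 ℓ ⊓ facetIdeal k ℬ ℓ from iInf_union]
  obtain ⟨φ, hφ⟩ := exists_linearMap_quotient_inf (facetIdeal k 𝒜 ℓ) (facetIdeal k ℬ ℓ)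
    (maxIdeal k (Fin n) ^ (n * ℓ)) (monomial a 1)
    fun y hy => monomial_mul_mem_sup_facetIdeal i.pos h hy
  refine nontrivial_localCohomology_one (maxIdeal k (Fin n))
    (quotMod k (facetIdeal k 𝒜 ℓ ⊓ facetIdeal k ℬ ℓ)) (n * ℓ) φ ?_
  rintro u hu ⟨f', hf'⟩
  obtain ⟨f, rfl⟩ := Ideal.Quotient.mk_surjective f'
  have key : ∀ x, X x ^ u * (monomial a 1 - f) ∈ facetIdeal k 𝒜 ℓ ∧
      X x ^ u * f ∈ facetIdeal k ℬ ℓ := by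
    intro x
    have hx : (X x ^ u : MvPolynomial (Fin n) k) ∈ maxIdeal k (Fin n) ^ u :=
      Ideal.pow_mem_pow (Ideal.subset_span (Set.mem_range_self x)) u
    obtain ⟨b, hb, hbA, hbφ⟩ := hφ ⟨X x ^ u, Ideal.pow_le_pow_right hu hx⟩
    have h1 : Ideal.Quotient.mk (facetIdeal k 𝒜 ℓ ⊓ facetIdeal k ℬ ℓ) b =
        Ideal.Quotient.mk _ (X x ^ u * f) := hbφ.symm.trans (hf' _ hx)
    rw [Ideal.Quotient.eq] at h1
    constructor
    · have := Ideal.add_mem _ hbA h1.1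
      convert this using 1
      ring
    · have := Ideal.sub_mem _ hb h1.2
      convert this using 1
      ring
  have h1 := coeff_eq_zero_of_X_pow_mul_mem hF₀ hi haF₀ (key i).1
  have h2 := coeff_eq_zero_of_X_pow_mul_mem hG₀ hj haG₀ (key j).2
  rw [coeff_sub, h2, sub_zero, coeff_monomial, if_pos rfl] at h1
  exact one_ne_zero h1

end

section
variable {n : ℕ}

theorem isFacet_degreeComplex_iff {K : Set (Finset (Fin n))} {a : Fin n → ℕ} {ℓ : ℕ}
    {F : Finset (Fin n)} :
    IsFacet (degreeComplex K a ℓ) F ↔ IsFacet K F ∧ ∑ i ∈ Fᶜ, a i ≤ ℓ - 1 := by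
  constructor
  · rintro ⟨⟨G, hG, hFG, ha⟩, hF⟩
    obtain rfl := hF G ⟨G, hG, subset_rfl, ha⟩ hFG
    exact ⟨hG, ha⟩
  · rintro ⟨hF, ha⟩
    refine ⟨⟨F, hF, subset_rfl, ha⟩, ?_⟩
    rintro G ⟨H, hH, hGH, -⟩ hFG
    obtain rfl := hF.2 H hH.1 (hFG.trans hGH)
    exact hGH.antisymm hFG

theorem exists_weight_concentrated {m : ℕ} {F₀ G₀ : Finset (Fin n)}
    (hd : Disjoint F₀ G₀) (a : Fin n → ℕ) (ha : m < ∑ i, a i) (hF₀ : ∑ i ∈ F₀ᶜ, a i = m)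
    (hG₀ : ∑ i ∈ G₀ᶜ, a i = m) :
    ∃ b : Fin n → ℕ, ∑ i ∈ F₀ᶜ, b i = m ∧ ∑ i ∈ G₀ᶜ, b i = m ∧
      ∀ F : Finset (Fin n), ∑ i ∈ Fᶜ, b i ≤ m →
        ∑ i ∈ Fᶜ, a i ≤ m ∧ ((F ∩ F₀).Nonempty ∨ (F ∩ G₀).Nonempty) := by
  set a₁ : Fin n → ℕ := fun i => if i ∈ F₀ ∪ G₀ then a i else 0 with ha₁
  set a₂ : Fin n → ℕ := fun i => if i ∈ F₀ ∪ G₀ then 0 else a i with ha₂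
  have hsplit : ∀ F : Finset (Fin n), ∑ i ∈ F, a i = ∑ i ∈ F, a₁ i + ∑ i ∈ F, a₂ i := by
    intro F
    rw [← Finset.sum_add_distrib]
    refine Finset.sum_congr rfl fun i _ => ?_
    simp only [ha₁, ha₂]
    split_ifs <;> simp
  have hzero : ∀ F ⊆ F₀ ∪ G₀, ∑ i ∈ F, a₂ i = 0 := fun F hF =>
    Finset.sum_eq_zero fun i hi => if_pos (hF hi)
  have hcompl : ∀ (F : Finset (Fin n)) (f : Fin n → ℕ),
      ∑ i ∈ F, f i + ∑ i ∈ Fᶜ, f i = ∑ i, f i := fun F f => Finset.sum_add_sum_compl F f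
  set s := ∑ i ∈ F₀, a i with hs
  have hsG : ∑ i ∈ G₀, a i = s := by
    have h1 := hcompl F₀ a
    have h2 := hcompl G₀ a
    omega
  have hFs : ∑ i ∈ F₀, a₁ i = s := by
    have h1 := hsplit F₀
    have h2 := hzero F₀ Finset.subset_union_left
    omega
  have hGs : ∑ i ∈ G₀, a₁ i = s := by
    have h1 := hsplit G₀
    have h2 := hzero G₀ Finset.subset_union_right
    omega
  have htot : ∑ i, a₁ i = s + s := by
    have h1 := hcompl (F₀ ∪ G₀) a₁
    rw [Finset.sum_union hd] at h1
    have h2 : ∑ i ∈ (F₀ ∪ G₀)ᶜ, a₁ i = 0 :=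
      Finset.sum_eq_zero fun i hi => if_neg (Finset.mem_compl.1 hi)
    omega
  have ha0 := hcompl F₀ a
  have hau := hsplit Finset.univ
  have hs0 : 0 < s := by omega
  have hsm : s ≤ m := by omega
  set q := m / s with hq
  set r := m % s with hr
  have hqr : q * s + r = m := Nat.div_add_mod' m s
  have hq1 : 1 ≤ q := Nat.div_pos hsm hs0
  have hrs : r < s := Nat.mod_lt _ hs0
  have hsq : s ≤ q * s := Nat.le_mul_of_pos_left s hq1
  obtain ⟨g, hga, hgr⟩ := Finsupp.exists_le_degree_eq (Finsupp.equivFunOnFinite.symm a₂) r (by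
    rw [Finsupp.degree_eq_sum]
    simp only [Finsupp.coe_equivFunOnFinite_symm]
    omega)
  rw [Finsupp.degree_eq_sum] at hgr
  replace hga : ∀ i, g i ≤ a₂ i := fun i => hga i
  have hg0 : ∀ F : Finset (Fin n), ∑ i ∈ F, g i ≤ ∑ i ∈ F, a₂ i := fun F =>
    Finset.sum_le_sum fun i _ => hga i
  have hb : ∀ F : Finset (Fin n), ∑ i ∈ F, (q * a₁ i + g i) =
      q * ∑ i ∈ F, a₁ i + ∑ i ∈ F, g i := fun F => by
    rw [Finset.sum_add_distrib, Finset.mul_sum]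
  have hbtot := hb Finset.univ
  rw [htot, hgr, mul_add] at hbtot
  refine ⟨fun i => q * a₁ i + g i, ?_, ?_, fun F hF => ?_⟩
  · have h1 := hcompl F₀ fun i => q * a₁ i + g i
    beta_reduce at h1 ⊢
    have h2 := hb F₀
    have h3 := hg0 F₀
    rw [hzero F₀ Finset.subset_union_left] at h3
    rw [hFs] at h2
    omega
  · have h1 := hcompl G₀ fun i => q * a₁ i + g i
    beta_reduce at h1 ⊢
    have h2 := hb G₀
    have h3 := hg0 G₀
    rw [hzero G₀ Finset.subset_union_right] at h3
    rw [hGs] at h2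
    omega
  · have h1 := hcompl F fun i => q * a₁ i + g i
    beta_reduce at h1 hF
    have h2 := hb F
    have h3 := hg0 F
    have h4 : ∑ i ∈ F, a₂ i ≤ q * ∑ i ∈ F, a₂ i := Nat.le_mul_of_pos_left _ hq1
    have h5 := hsplit F
    have h6 := hcompl F a
    have h7 : q * s ≤ q * ∑ i ∈ F, a i := by
      rw [h5, mul_add]
      omega
    have h8 := Nat.le_of_mul_le_mul_left h7 hq1
    refine ⟨by omega, ?_⟩
    by_contra! hne
    have h9 : ∑ i ∈ F, a₁ i = 0 := Finset.sum_eq_zero fun i hi => if_neg fun hi' => by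
      rcases Finset.mem_union.1 hi' with hi' | hi'
      · exact Finset.notMem_empty i (hne.1 ▸ Finset.mem_inter.2 ⟨hi, hi'⟩)
      · exact Finset.notMem_empty i (hne.2 ▸ Finset.mem_inter.2 ⟨hi, hi'⟩)
    have h10 : ∑ i ∈ F, g i ≤ r := by
      rw [← hgr]
      exact Finset.sum_le_univ_sum_of_nonneg fun _ => Nat.zero_le _
    rw [h9, mul_zero] at h2
    omega

theorem H1NE_symbPow_srIdeal {k : Type} [Field k] {ℓ : ℕ} (hℓ : 2 ≤ ℓ)
    {K : Set (Finset (Fin n))} (hK : IsComplex K) {F₀ G₀ : Finset (Fin n)}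
    (hF₀ : IsFacet K F₀) (hG₀ : IsFacet K G₀) (hFG : F₀ ∩ G₀ = ∅) (a : Fin n → ℕ)
    (ha : ℓ ≤ ∑ i, a i) (haF₀ : ∑ i ∈ F₀ᶜ, a i = ℓ - 1) (haG₀ : ∑ i ∈ G₀ᶜ, a i = ℓ - 1)
    (h : ∀ F G : Finset (Fin n), IsFacet (degreeComplex K a ℓ) F →
      IsFacet (degreeComplex K a ℓ) G → (F ∩ F₀).Nonempty → (G ∩ G₀).Nonempty → F ∩ G = ∅) :
    H1NE k (symbPow (srIdeal k K) ℓ) := by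
  have hd : Disjoint F₀ G₀ := Finset.disjoint_iff_inter_eq_empty.2 hFG
  have hne : ∀ F : Finset (Fin n), ∑ i ∈ Fᶜ, a i = ℓ - 1 → F.Nonempty := by
    rintro F hF
    by_contra hF'
    rw [Finset.not_nonempty_iff_eq_empty.1 hF', Finset.compl_empty] at hF
    omega
  obtain ⟨b, hbF₀, hbG₀, hb⟩ :=
    exists_weight_concentrated hd a (by omega) haF₀ haG₀
  have hunion : {F | IsFacet K F} =
      {F | IsFacet K F ∧ (F ∩ F₀).Nonempty} ∪ {F | IsFacet K F ∧ ¬ (F ∩ F₀).Nonempty} := by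
    ext F
    simp only [Set.mem_ofPred_eq, Set.mem_union]
    tauto
  rw [symbPow_srIdeal_eq hK, hunion]
  refine H1NE_facetIdeal_union (F₀ := F₀) (G₀ := G₀) ⟨hF₀, ?_⟩ ⟨hG₀, ?_⟩ (hne _ haF₀)
    (hne _ haG₀) (Finsupp.equivFunOnFinite.symm b) ?_ ?_ ?_
  · rw [Finset.inter_self]
    exact hne _ haF₀
  · rw [Finset.inter_comm, hFG]
    exact Finset.not_nonempty_empty
  · simp only [Finsupp.coe_equivFunOnFinite_symm]
    omega
  · simp only [Finsupp.coe_equivFunOnFinite_symm]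
    omega
  · rintro F ⟨hF, hFF₀⟩ G ⟨hG, hGF₀⟩ hbF hbG
    simp only [Finsupp.coe_equivFunOnFinite_symm] at hbF hbG
    have h1 := (hb F (by omega)).1
    obtain ⟨h2, h3⟩ := hb G (by omega)
    exact Finset.disjoint_iff_inter_eq_empty.2 (h F G (isFacet_degreeComplex_iff.2 ⟨hF, h1⟩)
      (isFacet_degreeComplex_iff.2 ⟨hG, h2⟩) hFF₀ (h3.resolve_left hGF₀))

end

section
variable {k : Type} [Field k] {n : ℕ} {𝓕 : Set (Finset (Fin n))} {ℓ : ℕ}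

/-- The coefficient at `w` of a chosen representative of a residue class. -/
noncomputable def quotCoeff {I : Ideal (MvPolynomial (Fin n) k)} (w : Fin n →₀ ℕ)
    (x : MvPolynomial (Fin n) k ⧸ I) : k :=
  coeff w (Function.surjInv Ideal.Quotient.mk_surjective x)

theorem quotCoeff_mk {F : Finset (Fin n)} (hF : F ∈ 𝓕) {w : Fin n →₀ ℕ}
    (hw : ∑ i ∈ Fᶜ, w i < ℓ) (p : MvPolynomial (Fin n) k) :
    quotCoeff w (Ideal.Quotient.mk (facetIdeal k 𝓕 ℓ) p) = coeff w p := by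
  have h := Ideal.Quotient.eq.1 (Function.surjInv_eq Ideal.Quotient.mk_surjective
    (Ideal.Quotient.mk (facetIdeal k 𝓕 ℓ) p))
  rw [quotCoeff, ← sub_eq_zero, ← coeff_sub]
  by_contra hne
  exact hw.not_ge (mem_facetIdeal_iff.1 h F hF w hne)

theorem quotCoeff_monomial_smul {F : Finset (Fin n)} (hF : F ∈ 𝓕) {w : Fin n →₀ ℕ}
    (hw : ∑ i ∈ Fᶜ, w i < ℓ) (e : Fin n →₀ ℕ)
    (x : MvPolynomial (Fin n) k ⧸ facetIdeal k 𝓕 ℓ) :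
    quotCoeff w (monomial e (1 : k) • x) = if e ≤ w then quotCoeff (w - e) x else 0 := by
  obtain ⟨p, rfl⟩ := Ideal.Quotient.mk_surjective x
  change quotCoeff w (Ideal.Quotient.mk _ (monomial e 1 * p)) = _
  rw [quotCoeff_mk hF hw, coeff_monomial_mul', one_mul]
  split_ifs with h
  · rw [quotCoeff_mk hF]
    exact (Finset.sum_le_sum fun i _ => Nat.sub_le (w i) (e i)).trans_lt hw
  · rfl

theorem ext_quotCoeff {x y : MvPolynomial (Fin n) k ⧸ facetIdeal k 𝓕 ℓ}
    (h : ∀ F ∈ 𝓕, ∀ w : Fin n →₀ ℕ, ∑ i ∈ Fᶜ, w i < ℓ → quotCoeff w x = quotCoeff w y) :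
    x = y := by
  obtain ⟨p, rfl⟩ := Ideal.Quotient.mk_surjective x
  obtain ⟨q, rfl⟩ := Ideal.Quotient.mk_surjective y
  rw [Ideal.Quotient.eq, mem_facetIdeal_iff]
  intro F hF w hw
  by_contra! hlt
  refine hw ?_
  rw [coeff_sub, ← quotCoeff_mk hF hlt, ← quotCoeff_mk hF hlt, h F hF w hlt, sub_self]

theorem sum_compl_single_add {F : Finset (Fin n)} {i : Fin n} (hi : i ∈ F) (t : ℕ)
    (w : Fin n →₀ ℕ) : ∑ j ∈ Fᶜ, (Finsupp.single i t + w) j = ∑ j ∈ Fᶜ, w j := by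
  refine Finset.sum_congr rfl fun j hj => ?_
  have hij : j ≠ i := by
    rintro rfl
    exact Finset.mem_compl.1 hj hi
  simp [Finsupp.single_eq_of_ne hij]

variable {t : ℕ} {Φ : (Fin n →₀ ℕ) → MvPolynomial (Fin n) k ⧸ facetIdeal k 𝓕 ℓ}

theorem quotCoeff_eq_quotCoeff_single
    (hΦ : ∀ b e, t ≤ b.degree → Φ (e + b) = monomial e (1 : k) • Φ b)
    {F : Finset (Fin n)} (hF : F ∈ 𝓕) {i : Fin n} (hi : i ∈ F) {b d : Fin n →₀ ℕ}
    (hb : t ≤ b.degree) (hd : ∑ j ∈ Fᶜ, (b + d) j < ℓ) :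
    quotCoeff (b + d) (Φ b) = quotCoeff (Finsupp.single i t + d) (Φ (Finsupp.single i t)) := by
  have hlive := hd
  rw [← sum_compl_single_add hi t] at hlive
  have h1 := quotCoeff_monomial_smul hF hlive (Finsupp.single i t) (Φ b)
  have h2 := quotCoeff_monomial_smul hF hlive b (Φ (Finsupp.single i t))
  rw [if_pos le_self_add, add_tsub_cancel_left, ← hΦ _ _ hb, add_left_comm,
    add_comm _ b] at h1
  rw [add_left_comm, if_pos le_self_add, add_tsub_cancel_left,
    ← hΦ _ _ (Finsupp.degree_single i t).ge] at h2
  exact h1.symm.trans h2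

theorem quotCoeff_eq_zero
    (hΦ : ∀ b e, t ≤ b.degree → Φ (e + b) = monomial e (1 : k) • Φ b)
    (hcard : ∀ F ∈ 𝓕, F.Nontrivial)
    {F : Finset (Fin n)} (hF : F ∈ 𝓕) {b w : Fin n →₀ ℕ}
    (hb : t ≤ b.degree) (hw : ∑ j ∈ Fᶜ, w j < ℓ) (hbw : ¬ b ≤ w) :
    quotCoeff w (Φ b) = 0 := by
  obtain ⟨j, hj⟩ := not_forall.1 hbw
  obtain ⟨i, hi, hij⟩ := (hcard F hF).exists_ne j
  have hlive := hw
  rw [← sum_compl_single_add hi t] at hlive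
  have h1 := quotCoeff_monomial_smul hF hlive (Finsupp.single i t) (Φ b)
  have h2 := quotCoeff_monomial_smul hF hlive b (Φ (Finsupp.single i t))
  rw [if_pos le_self_add, add_tsub_cancel_left, ← hΦ _ _ hb] at h1
  rw [if_neg, ← hΦ _ _ (Finsupp.degree_single i t).ge, add_comm b] at h2
  · exact h1.symm.trans h2
  · intro hle
    have := hle j
    rw [Finsupp.add_apply, Finsupp.single_eq_of_ne hij.symm, zero_add] at this
    exact hj this

theorem exists_eq_monomial_smul
    (hΦ : ∀ b e, t ≤ b.degree → Φ (e + b) = monomial e (1 : k) • Φ b)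
    (hcard : ∀ F ∈ 𝓕, F.Nontrivial)
    (hconn : ∀ d : Fin n →₀ ℕ, ∀ F₀ ∈ 𝓕, ∀ G₀ ∈ 𝓕, ∑ i ∈ F₀ᶜ, d i < ℓ → ∑ i ∈ G₀ᶜ, d i < ℓ →
      ∃ F ∈ 𝓕, ∃ G ∈ 𝓕, ∑ i ∈ Fᶜ, d i < ℓ ∧ ∑ i ∈ Gᶜ, d i < ℓ ∧
        (F ∩ F₀).Nonempty ∧ (G ∩ G₀).Nonempty ∧ (F ∩ G).Nonempty) :
    ∃ f, ∀ b, t ≤ b.degree → Φ b = monomial b (1 : k) • f := by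
  classical
  set g : Fin n → (Fin n →₀ ℕ) → k := fun i d =>
    quotCoeff (Finsupp.single i t + d) (Φ (Finsupp.single i t)) with hg
  have hface : ∀ F ∈ 𝓕, ∀ d : Fin n →₀ ℕ, ∑ i ∈ Fᶜ, d i < ℓ → ∀ i ∈ F, ∀ j ∈ F,
      g i d = g j d := fun F hF d hd i hi j hj =>
    quotCoeff_eq_quotCoeff_single hΦ hF hj (Finsupp.degree_single i t).ge
      (by rwa [sum_compl_single_add hi])
  have hg_eq : ∀ F ∈ 𝓕, ∀ G ∈ 𝓕, ∀ d : Fin n →₀ ℕ, ∑ i ∈ Fᶜ, d i < ℓ → ∑ i ∈ Gᶜ, d i < ℓ →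
      ∀ i ∈ F, ∀ j ∈ G, g i d = g j d := by
    intro F₀ hF₀ G₀ hG₀ d hdF₀ hdG₀ i hi j hj
    obtain ⟨F, hF, G, hG, hdF, hdG, ⟨u, hu⟩, ⟨v, hv⟩, ⟨x, hx⟩⟩ := hconn d F₀ hF₀ G₀ hG₀ hdF₀ hdG₀
    rw [Finset.mem_inter] at hu hv hx
    calc g i d = g u d := hface F₀ hF₀ d hdF₀ i hi u hu.2
      _ = g x d := hface F hF d hdF u hu.1 x hx.1
      _ = g v d := hface G hG d hdG x hx.2 v hv.1
      _ = g j d := hface G₀ hG₀ d hdG₀ v hv.2 j hj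
  let P : (Fin n →₀ ℕ) → Fin n → Prop := fun d i => ∃ F ∈ 𝓕, ∑ i ∈ Fᶜ, d i < ℓ ∧ i ∈ F
  let γ : (Fin n →₀ ℕ) → k := fun d => if h : ∃ i, P d i then g h.choose d else 0
  have hγ : ∀ F ∈ 𝓕, ∀ d : Fin n →₀ ℕ, ∑ i ∈ Fᶜ, d i < ℓ → ∀ i ∈ F, γ d = g i d := by
    intro F hF d hd i hi
    have h : ∃ i, P d i := ⟨i, F, hF, hd, hi⟩
    obtain ⟨G, hG, hdG, hjG⟩ := h.choose_spec
    rw [show γ d = g h.choose d from dif_pos h]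
    exact hg_eq G hG F hF d hdG hd _ hjG i hi
  let D : Finset (Fin n →₀ ℕ) := Finset.univ.biUnion fun i =>
    (Function.surjInv Ideal.Quotient.mk_surjective (Φ (Finsupp.single i t))).support.image
      fun w => w - Finsupp.single i t
  have hD : ∀ d, γ d ≠ 0 → d ∈ D := by
    intro d hd
    have h : ∃ i, P d i := by
      by_contra h
      exact hd (dif_neg h)
    rw [show γ d = g h.choose d from dif_pos h] at hd
    exact Finset.mem_biUnion.2 ⟨h.choose, Finset.mem_univ _, Finset.mem_image.2
      ⟨_, mem_support_iff.2 hd, add_tsub_cancel_left _ _⟩⟩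
  let f : MvPolynomial (Fin n) k := ∑ d ∈ D, monomial d (γ d)
  have hf : ∀ d, coeff d f = γ d := by
    intro d
    simp only [f, coeff_sum, coeff_monomial, Finset.sum_ite_eq']
    by_cases hd : d ∈ D
    · rw [if_pos hd]
    · rw [if_neg hd]
      by_contra hne
      exact hd (hD d (Ne.symm hne))
  refine ⟨Ideal.Quotient.mk _ f, fun b hb => ext_quotCoeff fun F hF w hw => ?_⟩
  rw [quotCoeff_monomial_smul hF hw]
  split_ifs with hbw
  · obtain ⟨d, rfl⟩ := le_iff_exists_add.1 hbw
    have hd : ∑ i ∈ Fᶜ, d i < ℓ := lt_of_le_of_lt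
      (Finset.sum_le_sum fun i _ => Nat.le_add_left (d i) (b i)) hw
    rw [add_tsub_cancel_left, quotCoeff_mk hF hd, hf]
    obtain ⟨i, hi⟩ := (hcard F hF).nonempty
    rw [hγ F hF d hd i hi]
    exact quotCoeff_eq_quotCoeff_single hΦ hF hi hb hw
  · exact quotCoeff_eq_zero hΦ hcard hF hb hw hbw

theorem subsingleton_localCohomology_facetIdeal
    (hcard : ∀ F ∈ 𝓕, F.Nontrivial)
    (hconn : ∀ d : Fin n →₀ ℕ, ∀ F₀ ∈ 𝓕, ∀ G₀ ∈ 𝓕, ∑ i ∈ F₀ᶜ, d i < ℓ → ∑ i ∈ G₀ᶜ, d i < ℓ →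
      ∃ F ∈ 𝓕, ∃ G ∈ 𝓕, ∑ i ∈ Fᶜ, d i < ℓ ∧ ∑ i ∈ Gᶜ, d i < ℓ ∧
        (F ∩ F₀).Nonempty ∧ (G ∩ G₀).Nonempty ∧ (F ∩ G).Nonempty) :
    ¬ H1NE k (facetIdeal k 𝓕 ℓ) := by
  classical
  rw [H1NE, not_nontrivial_iff_subsingleton]
  refine subsingleton_localCohomology_one _ _ fun t φ => ?_
  have hmem : ∀ b : Fin n →₀ ℕ, t ≤ b.degree →
      monomial b (1 : k) ∈ maxIdeal k (Fin n) ^ t := fun b hb =>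
    (mem_pow_idealOfVars_iff t _).2 fun w hw => by
      rw [Finset.mem_singleton.1 (support_monomial_subset hw)]
      exact hb
  let Φ : (Fin n →₀ ℕ) → MvPolynomial (Fin n) k ⧸ facetIdeal k 𝓕 ℓ := fun b =>
    if h : t ≤ b.degree then φ ⟨monomial b 1, hmem b h⟩ else 0
  obtain ⟨f, hf⟩ := exists_eq_monomial_smul (t := t) (Φ := Φ) (fun b e hb => by
    have heb : t ≤ (e + b).degree := by
      rw [map_add]
      omega
    rw [show Φ (e + b) = _ from dif_pos heb, show Φ b = _ from dif_pos hb]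
    refine Eq.trans ?_ (φ.map_smul (monomial e (1 : k)) ⟨monomial b 1, hmem b hb⟩)
    congr 2
    simp [monomial_mul]) hcard hconn
  refine ⟨f, fun ⟨y, hy⟩ => ?_⟩
  have hspan : maxIdeal k (Fin n) ^ t =
      Ideal.span ((monomial · (1 : k)) '' (Finsupp.degree ⁻¹' {t})) :=
    pow_idealOfVars_eq_span t
  have hy' := hy
  rw [hspan] at hy'
  refine Submodule.span_induction (p := fun y _ => ∀ hy, φ ⟨y, hy⟩ = y • f)
    ?_ ?_ ?_ ?_ hy' hy
  · rintro _ ⟨b, hb, rfl⟩ hy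
    have hb' : t ≤ b.degree := (Set.mem_preimage.1 hb).ge
    exact (dif_pos hb').symm.trans (hf b hb')
  · intro h0
    rw [zero_smul]
    exact φ.map_zero
  · intro x y hx hy ihx ihy hxy
    rw [add_smul, ← ihx (hspan ▸ hx), ← ihy (hspan ▸ hy)]
    exact φ.map_add ⟨x, _⟩ ⟨y, _⟩
  · intro c x hx ihx hcx
    rw [smul_assoc, ← ihx (hspan ▸ hx)]
    exact φ.map_smul c ⟨x, _⟩

end

section
variable {n ℓ : ℕ} {K : Set (Finset (Fin n))}

theorem exists_connecting_facets_of_sum_lt (hℓ : 2 ≤ ℓ)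
    (h : ∀ F₀ G₀ : Finset (Fin n), IsFacet K F₀ → IsFacet K G₀ → F₀ ∩ G₀ = ∅ →
        ∀ a : Fin n → ℕ, ℓ ≤ ∑ i, a i →
          (∑ i ∈ F₀ᶜ, a i) = ℓ - 1 → (∑ i ∈ G₀ᶜ, a i) = ℓ - 1 →
          ∃ F G : Finset (Fin n),
            IsFacet (degreeComplex K a ℓ) F ∧ IsFacet (degreeComplex K a ℓ) G ∧
            (F ∩ F₀).Nonempty ∧ (G ∩ G₀).Nonempty ∧ (F ∩ G).Nonempty)
    {F₀ G₀ : Finset (Fin n)} (hF₀ : IsFacet K F₀) (hG₀ : IsFacet K G₀) (hF₀' : F₀.Nonempty)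
    (hG₀' : G₀.Nonempty) (d : Fin n → ℕ) (hdF₀ : ∑ i ∈ F₀ᶜ, d i < ℓ)
    (hdG₀ : ∑ i ∈ G₀ᶜ, d i < ℓ) :
    ∃ F, IsFacet K F ∧ ∃ G, IsFacet K G ∧ ∑ i ∈ Fᶜ, d i < ℓ ∧ ∑ i ∈ Gᶜ, d i < ℓ ∧
      (F ∩ F₀).Nonempty ∧ (G ∩ G₀).Nonempty ∧ (F ∩ G).Nonempty := by
  by_cases hFG : F₀ ∩ G₀ = ∅
  swap
  · exact ⟨F₀, hF₀, G₀, hG₀, hdF₀, hdG₀, by rwa [Finset.inter_self],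
      by rwa [Finset.inter_self], Finset.nonempty_iff_ne_empty.2 hFG⟩
  have hd := Finset.disjoint_iff_inter_eq_empty.2 hFG
  by_cases hsmall : ∑ i, d i < ℓ ∧ d ≠ 0
  · obtain ⟨F, hF, G, hG, -, -, hFG⟩ :=
      exists_connecting_facets_of_sum_lt hℓ h hF₀ hG₀ hF₀' hG₀' 0 (by simp; omega) (by simp; omega)
    have hlt : ∀ F : Finset (Fin n), ∑ i ∈ Fᶜ, d i < ℓ := fun F =>
      (Finset.sum_le_sum_of_subset (Finset.subset_univ _)).trans_lt hsmall.1
    exact ⟨F, hF, G, hG, hlt F, hlt G, hFG⟩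
  obtain ⟨i, hi⟩ := hF₀'
  obtain ⟨j, hj⟩ := hG₀'
  have hiG : i ∉ G₀ := Finset.disjoint_left.1 hd hi
  have hjF : j ∉ F₀ := Finset.disjoint_right.1 hd hj
  set u := ℓ - 1 - ∑ x ∈ G₀ᶜ, d x with hu
  set v := ℓ - 1 - ∑ x ∈ F₀ᶜ, d x with hv
  set a : Fin n → ℕ := fun x => d x + ((if i = x then u else 0) + if j = x then v else 0) with ha
  have hsum : ∀ s : Finset (Fin n), ∑ x ∈ s, a x =
      ∑ x ∈ s, d x + ((if i ∈ s then u else 0) + if j ∈ s then v else 0) := fun s => by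
    simp only [ha, Finset.sum_add_distrib, Finset.sum_ite_eq]
  have hle : ∀ s : Finset (Fin n), ∑ x ∈ s, d x ≤ ∑ x ∈ s, a x := fun s =>
    (hsum s).symm ▸ Nat.le_add_right _ _
  have hatot : ℓ ≤ ∑ x, a x := by
    by_cases hd0 : d = 0
    · rw [hsum]
      simp only [hd0, Pi.zero_apply, Finset.sum_const_zero, Finset.mem_univ, if_true] at hu hv ⊢
      omega
    · have := hle Finset.univ
      have : ¬ ∑ i, d i < ℓ := fun hlt => hsmall ⟨hlt, hd0⟩
      omega
  obtain ⟨F, G, hF, hG, hFG⟩ := h F₀ G₀ hF₀ hG₀ hFG a hatot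
    (by
      rw [hsum, if_neg (by simpa using hi), if_pos (by simpa using hjF)]
      omega)
    (by
      rw [hsum, if_pos (by simpa using hiG), if_neg (by simpa using hj)]
      omega)
  rw [isFacet_degreeComplex_iff] at hF hG
  have hF' := hle Fᶜ
  have hG' := hle Gᶜ
  exact ⟨F, hF.1, G, hG.1, by omega, by omega, hFG⟩
termination_by if d = 0 then 0 else 1
decreasing_by simp [hsmall.2]

theorem nontrivial_of_isFacet (hℓ : 2 ≤ ℓ) (hdim : ∃ F ∈ K, 2 ≤ F.card)
    (h : ∀ F₀ G₀ : Finset (Fin n), IsFacet K F₀ → IsFacet K G₀ → F₀ ∩ G₀ = ∅ →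
        ∀ a : Fin n → ℕ, ℓ ≤ ∑ i, a i →
          (∑ i ∈ F₀ᶜ, a i) = ℓ - 1 → (∑ i ∈ G₀ᶜ, a i) = ℓ - 1 →
          ∃ F G : Finset (Fin n),
            IsFacet (degreeComplex K a ℓ) F ∧ IsFacet (degreeComplex K a ℓ) G ∧
            (F ∩ F₀).Nonempty ∧ (G ∩ G₀).Nonempty ∧ (F ∩ G).Nonempty)
    {F₀ : Finset (Fin n)} (hF₀ : IsFacet K F₀) : F₀.Nontrivial := by
  obtain ⟨E, hE, hE2⟩ := hdim
  obtain ⟨G₀, hG₀, hEG⟩ := exists_facet_of_mem hE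
  have hG2 : 2 ≤ G₀.card := hE2.trans (Finset.card_le_card hEG)
  by_contra hF₀'
  have hne : F₀ ≠ G₀ := by
    rintro rfl
    exact hF₀' (Finset.one_lt_card_iff_nontrivial.1 hG2)
  rcases F₀.eq_empty_or_nonempty with rfl | hF₀ne
  · exact hne (hF₀.2 G₀ hG₀.1 (Finset.empty_subset _)).symm
  obtain ⟨j, rfl⟩ : ∃ j, F₀ = {j} := by
    rw [← Finset.one_lt_card_iff_nontrivial] at hF₀'
    have := hF₀ne.card_pos
    exact Finset.card_eq_one.1 (by omega)
  have key : ∀ F, IsFacet K F → j ∈ F → F = {j} := fun F hF hj =>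
    hF₀.2 F hF.1 (Finset.singleton_subset_iff.2 hj)
  obtain ⟨F, hF, G, hG, -, -, ⟨x, hx⟩, ⟨y, hy⟩, ⟨z, hz⟩⟩ :=
    exists_connecting_facets_of_sum_lt hℓ h hF₀ hG₀ hF₀ne
      (Finset.card_pos.1 (by omega)) 0 (by simp; omega) (by simp; omega)
  rw [Finset.mem_inter] at hx hy hz
  obtain rfl := key F hF (Finset.mem_singleton.1 hx.2 ▸ hx.1)
  obtain rfl := key G hG (Finset.mem_singleton.1 hz.1 ▸ hz.2)
  exact hne (key G₀ hG₀ (Finset.mem_singleton.1 hy.1 ▸ hy.2)).symm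

end

/-- Theorem `1st local coho`: for a simplicial complex `Δ` on `[n]`
with `dim Δ ≥ 1` and `ℓ ≥ 2`: `H^1_m(S/I_Δ^(ℓ)) = 0` iff for all disjoint facets
`F₀, G₀` of `Δ` and all `a ∈ ℕ^n` with `∑ a_i ≥ ℓ`, `∑_{i ∉ F₀} a_i = ℓ - 1` and
`∑_{i ∉ G₀} a_i = ℓ - 1`, there are facets `F, G` of `Δ_a(I_Δ^(ℓ))` with
`F ∩ F₀ ≠ ∅`, `G ∩ G₀ ≠ ∅` and `F ∩ G ≠ ∅`. -/
theorem H1_symbPow_vanishes_iff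
    (k : Type) [Field k] (n ℓ : ℕ) (hℓ : 2 ≤ ℓ)
    (K : Set (Finset (Fin n))) (hK : IsComplex K)
    (hdim : ∃ F ∈ K, 2 ≤ F.card) :
    ¬ H1NE k (symbPow (srIdeal k K) ℓ) ↔
      ∀ F₀ G₀ : Finset (Fin n), IsFacet K F₀ → IsFacet K G₀ → F₀ ∩ G₀ = ∅ →
        ∀ a : Fin n → ℕ, ℓ ≤ ∑ i, a i →
          (∑ i ∈ F₀ᶜ, a i) = ℓ - 1 → (∑ i ∈ G₀ᶜ, a i) = ℓ - 1 →
          ∃ F G : Finset (Fin n),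
            IsFacet (degreeComplex K a ℓ) F ∧ IsFacet (degreeComplex K a ℓ) G ∧
            (F ∩ F₀).Nonempty ∧ (G ∩ G₀).Nonempty ∧ (F ∩ G).Nonempty := by
  constructor
  · intro hH F₀ G₀ hF₀ hG₀ hFG a ha haF₀ haG₀
    by_contra! hne
    exact hH (H1NE_symbPow_srIdeal hℓ hK hF₀ hG₀ hFG a ha haF₀ haG₀ hne)
  · intro h
    have hnt : ∀ F, IsFacet K F → F.Nontrivial := fun F hF => nontrivial_of_isFacet hℓ hdim h hF
    rw [symbPow_srIdeal_eq hK]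
    exact subsingleton_localCohomology_facetIdeal hnt fun d F₀ hF₀ G₀ hG₀ hdF₀ hdG₀ =>
      exists_connecting_facets_of_sum_lt hℓ h hF₀ hG₀ (hnt F₀ hF₀).nonempty (hnt G₀ hG₀).nonempty
        d hdF₀ hdG₀

end SerrePaper
end
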